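/- arXiv:2411.19267 — 3 statements merged into one kernel-verified Lean document; each statement's English description precedes it below -/
import Mathlib

section
/- For every integer r ≥ 3 there exists an integer S₀ such that for every integer s ≥ S₀: every (r,r)-system (H,F) with |F| = s satisfies e(H) ≥ s² + (2r-7)s + (r-2)(r-3)/2, and there exists a maximal (r,r)-system (H,F) with |F| = s and e(H) = s² + (2r-7)s + (r-2)(r-3)/2. -/
open SimpleGraph

/-- `G` is `K_r`-saturated: `G` contains no `r`-clique, but adding any missing edge
creates an `r`-clique. -/
def Ksat (r : ℕ) {V : Type*} (G : SimpleGraph V) : Prop :=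
  G.CliqueFree r ∧ ∀ u v : V, u ≠ v → ¬ G.Adj u v →
    ¬ (G ⊔ fromEdgeSet {s(u, v)}).CliqueFree r

/-- `G` is twin-free: distinct vertices have distinct neighbourhoods. -/
def TwinFree {V : Type*} (G : SimpleGraph V) : Prop :=
  ∀ u v : V, G.neighborSet u = G.neighborSet v → u = v

/-- Minimum degree of `G` is at least `t`. -/
def MinDegGe {V : Type*} (G : SimpleGraph V) (t : ℕ) : Prop :=
  ∀ v : V, t ≤ (G.neighborSet v).ncard

/-- Every pair of distinct twins has a common neighbour of degree exactly `t`. -/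
def TwinCond {V : Type*} (G : SimpleGraph V) (t : ℕ) : Prop :=
  ∀ u v : V, u ≠ v → G.neighborSet u = G.neighborSet v →
    ∃ w : V, (G.neighborSet w).ncard = t ∧ G.Adj w u ∧ G.Adj w v

/-- An `(r,t)`-system. -/
def IsRTSystem (r t : ℕ) {V : Type*} [DecidableEq V] (H : SimpleGraph V)
    (F : Finset (Finset V)) : Prop :=
  H.CliqueFree r ∧
  (∀ S ∈ F, S.card = t ∧
    (H.induce (S : Set V)).CliqueFree (r - 1) ∧
    ∀ v : V, v ∉ S → ¬ (H.induce ((insert v S : Finset V) : Set V)).CliqueFree (r - 1)) ∧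
  (∀ S ∈ F, ∀ T ∈ F, S ≠ T → ¬ (H.induce ((S ∩ T : Finset V) : Set V)).CliqueFree (r - 2))

/-- A maximal `(r,t)`-system. -/
def IsMaxRTSystem (r t : ℕ) {V : Type*} [DecidableEq V] (H : SimpleGraph V)
    (F : Finset (Finset V)) : Prop :=
  IsRTSystem r t H F ∧
  ∀ u v : V, u ≠ v → ¬ H.Adj u v →
    ¬ (H ⊔ fromEdgeSet {s(u, v)}).CliqueFree r ∨
    ∃ S ∈ F, ¬ (((H ⊔ fromEdgeSet {s(u, v)}).induce (S : Set V)).CliqueFree (r - 1))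

/-- A `(3,t)`-system. -/
def Is3TSystem (t : ℕ) {V : Type*} [DecidableEq V] (H : SimpleGraph V)
    (F : Finset (Finset V)) : Prop :=
  H.CliqueFree 3 ∧
  (∀ S ∈ F, S.card = t ∧
    (∀ u ∈ S, ∀ v ∈ S, ¬ H.Adj u v) ∧
    (∀ v : V, v ∉ S → ∃ u ∈ S, H.Adj v u)) ∧
  (∀ S ∈ F, ∀ T ∈ F, S ≠ T → (S ∩ T).Nonempty)

/-- A maximal `(3,t)`-system. -/
def IsMax3TSystem (t : ℕ) {V : Type*} [DecidableEq V] (H : SimpleGraph V)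
    (F : Finset (Finset V)) : Prop :=
  Is3TSystem t H F ∧
  ∀ u v : V, u ≠ v → ¬ H.Adj u v →
    ¬ (H ⊔ fromEdgeSet {s(u, v)}).CliqueFree 3 ∨ ∃ S ∈ F, u ∈ S ∧ v ∈ S

noncomputable def s3 (t m : ℕ) : ℕ :=
  sSup {a : ℕ | ∃ (H : SimpleGraph (Fin m)) (F : Finset (Finset (Fin m))),
    Is3TSystem t H F ∧ F.card = a}

noncomputable def ePrime (r t s : ℕ) : ℕ :=
  sInf {e : ℕ | ∃ (m : ℕ) (H : SimpleGraph (Fin m)) (F : Finset (Finset (Fin m))),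
    IsMaxRTSystem r t H F ∧ F.card = s ∧ H.edgeSet.ncard = e}

noncomputable def e3min (t s : ℕ) : ℕ :=
  sInf {e : ℕ | ∃ (m : ℕ) (H : SimpleGraph (Fin m)) (F : Finset (Finset (Fin m))),
    Is3TSystem t H F ∧ F.card = s ∧ H.edgeSet.ncard = e}

/-- An induced subgraph on a finite set contains an `n`-clique exactly when the ambient graph
has an `n`-clique inside that set. -/
lemma not_cliqueFree_induce_coe {V : Type*} (H : SimpleGraph V) (X : Finset V) (n : ℕ) :
    ¬ (H.induce (X : Set V)).CliqueFree n ↔ ∃ K ⊆ X, H.IsNClique n K := by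
  rw [cliqueFree_induce_iff]
  simp [CliqueFreeOn]

/-- A `(k + 3, k + 3)`-system, phrased through cliques of the ambient graph. -/
structure CliqueSystem (k : ℕ) {V : Type*} [DecidableEq V] (H : SimpleGraph V)
    (F : Finset (Finset V)) : Prop where
  cliqueFree : H.CliqueFree (k + 3)
  card_eq : ∀ S ∈ F, S.card = k + 3
  not_clique : ∀ S ∈ F, ∀ K ⊆ S, ¬ H.IsNClique (k + 2) K
  dominating : ∀ S ∈ F, ∀ v ∉ S, ∃ K ⊆ S, H.IsNClique (k + 1) K ∧ ∀ x ∈ K, H.Adj v x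
  inter : ∀ S ∈ F, ∀ T ∈ F, S ≠ T → ∃ K ⊆ S ∩ T, H.IsNClique (k + 1) K

lemma IsRTSystem.cliqueSystem {k : ℕ} {V : Type*} [DecidableEq V] {H : SimpleGraph V}
    {F : Finset (Finset V)} (h : IsRTSystem (k + 3) (k + 3) H F) : CliqueSystem k H F := by
  obtain ⟨h1, h2, h3⟩ := h
  have hnc : ∀ S ∈ F, ∀ K ⊆ S, ¬ H.IsNClique (k + 2) K := fun S hS K hK hc =>
    (not_cliqueFree_induce_coe H S _).2 ⟨K, hK, hc⟩ (h2 S hS).2.1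
  refine ⟨h1, fun S hS => (h2 S hS).1, hnc, fun S hS v hv => ?_, fun S hS T hT hne =>
    (not_cliqueFree_induce_coe H _ _).1 (h3 S hS T hT hne)⟩
  obtain ⟨K, hK, hc⟩ := (not_cliqueFree_induce_coe H _ _).1 ((h2 S hS).2.2 v hv)
  have hvK : v ∈ K := by
    by_contra hvK
    exact hnc S hS K ((Finset.subset_insert_iff_of_notMem hvK).1 hK) hc
  refine ⟨K.erase v, Finset.subset_insert_iff.1 hK, hc.erase_of_mem hvK, fun x hx => ?_⟩
  exact hc.1 hvK (Finset.mem_of_mem_erase hx) (Finset.ne_of_mem_erase hx).symm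

namespace CliqueSystem

variable {k : ℕ} {V : Type*} [DecidableEq V] {H : SimpleGraph V} {F : Finset (Finset V)}

/-- Few members of the family contain a given set of all but one of the possible vertices. -/
lemma card_filter_subset_le (h : CliqueSystem k H F) (X : Finset V) (hX : X.card = k + 2) :
    (F.filter (X ⊆ ·)).card ≤ k + 2 := by
  have hb : ∀ S ∈ F.filter (X ⊆ ·), ∃ b, b ∉ X ∧ insert b X = S := by
    intro S hS
    rw [Finset.mem_filter] at hS
    have := (Finset.exists_eq_insert_iff (s := X) (t := S)).2 ⟨hS.2, by
      rw [hX, h.card_eq S hS.1]⟩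
    simpa using this
  have : Nonempty V := ⟨(Finset.card_pos.1 (show 0 < X.card by omega)).choose⟩
  choose! b hbX hbS using hb
  have hinj : Set.InjOn b ((F.filter (X ⊆ ·) : Finset (Finset V)) : Set (Finset V)) := by
    intro S hS T hT hST
    rw [← hbS S hS, ← hbS T hT, hST]
  have hadj : H.IsClique ((F.filter (X ⊆ ·)).image b : Finset V) := by
    intro u hu v hv huv
    simp only [Finset.coe_image, Set.mem_image, Finset.mem_coe] at hu hv
    obtain ⟨S, hS, rfl⟩ := hu
    obtain ⟨T, hT, rfl⟩ := hv
    have hST : b S ∉ T := by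
      rw [← hbS T hT, Finset.mem_insert]
      exact not_or.2 ⟨huv, hbX S hS⟩
    obtain ⟨K, hKT, hK, hKadj⟩ := h.dominating T (Finset.mem_filter.1 hT).1 _ hST
    refine hKadj _ ?_
    by_contra hbK
    refine h.not_clique S (Finset.mem_filter.1 hS).1 (insert (b S) K) ?_ (hK.insert hKadj)
    refine (Finset.insert_subset_insert (b S) ?_).trans (hbS S hS).subset
    rwa [← hbS T hT, Finset.subset_insert_iff_of_notMem hbK] at hKT
  by_contra hlt
  have hfree := h.cliqueFree.mono (show k + 3 ≤ (F.filter (X ⊆ ·)).card by omega)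
  exact hfree _ ⟨hadj, Finset.card_image_of_injOn hinj⟩

lemma card_filter_insert_subset_le (h : CliqueSystem k H F) {Y : Finset V}
    (hY : Y.card = k + 1) {v : V} (hv : v ∉ Y) :
    (F.filter (insert v Y ⊆ ·)).card ≤ k + 2 :=
  h.card_filter_subset_le _ (by rw [Finset.card_insert_of_notMem hv, hY])

/-- A large system has a common core, which is a clique. -/
lemma exists_core (h : CliqueSystem k H F)
    (hF : 2 ^ (k + 3) * ((k + 3) * (k + 2)) + 1 < F.card) :
    ∃ Y, H.IsNClique (k + 1) Y ∧ ∀ S ∈ F, Y ⊆ S := by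
  obtain ⟨S₁, hS₁⟩ : F.Nonempty := Finset.card_pos.1 (by omega)
  have hf : ∀ S ∈ F.erase S₁, ∃ K ⊆ S₁ ∩ S, H.IsNClique (k + 1) K := fun S hS =>
    h.inter S₁ hS₁ S (Finset.mem_of_mem_erase hS) (Finset.ne_of_mem_erase hS).symm
  choose! f hfs hfc using hf
  obtain ⟨Y, -, hYc⟩ := Finset.exists_lt_card_fiber_of_mul_lt_card_of_maps_to
    (s := F.erase S₁) (t := S₁.powerset) (f := f) (n := (k + 3) * (k + 2))
    (fun S hS => Finset.mem_powerset.2 ((hfs S hS).trans Finset.inter_subset_left))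
    (by rw [Finset.card_powerset, h.card_eq S₁ hS₁, Finset.card_erase_of_mem hS₁]; omega)
  have hG : ∀ S ∈ (F.erase S₁).filter (f · = Y), S ∈ F ∧ Y ⊆ S ∧ H.IsNClique (k + 1) Y := by
    intro S hS
    obtain ⟨hS₁, rfl⟩ := Finset.mem_filter.1 hS
    exact ⟨Finset.mem_of_mem_erase hS₁, (hfs S hS₁).trans Finset.inter_subset_right, hfc S hS₁⟩
  obtain ⟨S₂, hS₂⟩ : ((F.erase S₁).filter (f · = Y)).Nonempty := Finset.card_pos.1 (by omega)
  have hY := (hG S₂ hS₂).2.2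
  refine ⟨Y, hY, fun T hT => ?_⟩
  by_contra hYT
  have hsub : (F.erase S₁).filter (f · = Y) ⊆
      (T \ Y).biUnion fun x => F.filter (insert x Y ⊆ ·) := by
    intro S hS
    obtain ⟨hSF, hYS, -⟩ := hG S hS
    obtain ⟨K, hK, hKc⟩ := h.inter S hSF T hT (by rintro rfl; exact hYT hYS)
    obtain ⟨x, hxK, hxY⟩ : ∃ x ∈ K, x ∉ Y := by
      by_contra! hKY
      have := Finset.eq_of_subset_of_card_le hKY (by rw [hY.2, hKc.2])
      exact hYT (this ▸ hK.trans Finset.inter_subset_right)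
    have hx := Finset.mem_inter.1 (hK hxK)
    simp only [Finset.mem_biUnion, Finset.mem_filter, Finset.mem_sdiff]
    exact ⟨x, ⟨hx.2, hxY⟩, hSF, Finset.insert_subset hx.1 hYS⟩
  have h1 := (Finset.card_le_card hsub).trans (Finset.card_biUnion_le_card_mul _ _ (k + 2)
    fun x hx => h.card_filter_insert_subset_le hY.2 (Finset.mem_sdiff.1 hx).2)
  have h2 : (T \ Y).card ≤ k + 3 := (Finset.card_le_card Finset.sdiff_subset).trans
    (h.card_eq T hT).le
  exact absurd (h1.trans (Nat.mul_le_mul_right _ h2)) (by omega)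

end CliqueSystem

/-- A clique system all of whose members contain the clique `Y`. -/
structure CoredCliqueSystem (k : ℕ) {V : Type*} [DecidableEq V] (H : SimpleGraph V)
    (F : Finset (Finset V)) (Y : Finset V) : Prop extends CliqueSystem k H F where
  core_isNClique : H.IsNClique (k + 1) Y
  core_subset : ∀ S ∈ F, Y ⊆ S

namespace CoredCliqueSystem

variable {k : ℕ} {V : Type*} [DecidableEq V] {H : SimpleGraph V} {F : Finset (Finset V)}
  {Y : Finset V}

lemma card_sdiff (h : CoredCliqueSystem k H F Y) {S : Finset V} (hS : S ∈ F) :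
    (S \ Y).card = 2 := by
  rw [Finset.card_sdiff_of_subset (h.core_subset S hS), h.card_eq S hS, h.core_isNClique.2]
  omega

lemma exists_not_adj (h : CoredCliqueSystem k H F Y) {S : Finset V} (hS : S ∈ F) {u : V}
    (hu : u ∈ S) : ∃ y ∈ Y, ¬ H.Adj u y := by
  by_contra! hadj
  exact h.not_clique S hS _ (Finset.insert_subset hu (h.core_subset S hS))
    (h.core_isNClique.insert hadj)

/-- Some member meets a given small set only inside the core. -/
lemma exists_mem_avoiding (h : CoredCliqueSystem k H F Y) (B : Finset V)
    (hB : B.card * (k + 2) < F.card) : ∃ S ∈ F, ∀ x ∈ S, x ∈ B → x ∈ Y := by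
  by_contra! hc
  have hsub : F ⊆ (B \ Y).biUnion fun x => F.filter (insert x Y ⊆ ·) := by
    intro S hS
    obtain ⟨x, hxS, hxB, hxY⟩ := hc S hS
    simp only [Finset.mem_biUnion, Finset.mem_filter, Finset.mem_sdiff]
    exact ⟨x, ⟨hxB, hxY⟩, hS, Finset.insert_subset hxS (h.core_subset S hS)⟩
  have h1 := (Finset.card_le_card hsub).trans (Finset.card_biUnion_le_card_mul _ _ (k + 2)
    fun x hx => h.card_filter_insert_subset_le h.core_isNClique.2 (Finset.mem_sdiff.1 hx).2)
  have h2 : (B \ Y).card ≤ B.card := Finset.card_le_card Finset.sdiff_subset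
  exact absurd (h1.trans (Nat.mul_le_mul_right _ h2)) (by omega)

/-- A large system contains many members that pairwise meet only in the core. -/
lemma exists_sunflower (h : CoredCliqueSystem k H F Y) (N : ℕ)
    (hN : N * (k + 3) * (k + 2) < F.card) :
    ∃ M ⊆ F, M.card = N ∧ ∀ S ∈ M, ∀ T ∈ M, S ≠ T → S ∩ T ⊆ Y := by
  induction N with
  | zero => exact ⟨∅, by simp⟩
  | succ n ih =>
    obtain ⟨M, hMF, hM, hMd⟩ := ih (lt_of_le_of_lt (by gcongr; omega) hN)
    have hcard : (M.biUnion id).card ≤ n * (k + 3) :=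
      hM ▸ Finset.card_biUnion_le_card_mul _ _ _ fun S hS => (h.card_eq S (hMF hS)).le
    obtain ⟨S, hS, hSa⟩ := h.exists_mem_avoiding (M.biUnion id)
      (lt_of_le_of_lt (by gcongr; exact hcard.trans (by gcongr; omega)) hN)
    have hST : ∀ T ∈ M, S ∩ T ⊆ Y := fun T hT x hx =>
      hSa x (Finset.mem_inter.1 hx).1
        (Finset.mem_biUnion.2 ⟨T, hT, (Finset.mem_inter.1 hx).2⟩)
    have hSM : S ∉ M := fun hSM => by
      have h1 := hST S hSM
      rw [Finset.inter_self] at h1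
      have := h.card_sdiff hS
      rw [Finset.sdiff_eq_empty_iff_subset.2 h1] at this
      simp at this
    refine ⟨insert S M, Finset.insert_subset hS hMF, by
      rw [Finset.card_insert_of_notMem hSM, hM], ?_⟩
    intro A hA B hB hAB
    rcases Finset.mem_insert.1 hA with rfl | hA'
    · exact hST B (Finset.mem_of_mem_insert_of_ne hB hAB.symm)
    · rcases Finset.mem_insert.1 hB with rfl | hB'
      · rw [Finset.inter_comm]
        exact hST A hA'
      · exact hMd A hA' B hB' hAB

end CoredCliqueSystem

/-- A set `K` of the same size as `Y` inside `Y ∪ {p, q}` that avoids `p` and differs from `Y`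
consists of `q` and all but one element of `Y`. -/
lemma exists_erase_subset_of_notMem {V : Type*} [DecidableEq V] {Y K : Finset V} {p q : V}
    (hK : K ⊆ insert p (insert q Y)) (hc : K.card = Y.card) (hq : q ∉ Y) (hp : p ∉ K)
    (hKY : K ≠ Y) : q ∈ K ∧ ∃ a ∈ Y, Y.erase a ⊆ K := by
  have hK' : K ⊆ insert q Y := (Finset.subset_insert_iff_of_notMem hp).1 hK
  have hqK : q ∈ K := by
    by_contra hqK
    exact hKY (Finset.eq_of_subset_of_card_le
      ((Finset.subset_insert_iff_of_notMem hqK).1 hK') hc.ge)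
  refine ⟨hqK, ?_⟩
  have h1 : (insert q Y \ K).card = 1 := by
    rw [Finset.card_sdiff_of_subset hK', Finset.card_insert_of_notMem hq]
    omega
  obtain ⟨a, ha⟩ := Finset.card_eq_one.1 h1
  have haK := Finset.mem_sdiff.1 (ha ▸ Finset.mem_singleton_self a)
  refine ⟨a, Finset.mem_of_mem_insert_of_ne haK.1 (by rintro rfl; exact haK.2 hqK), ?_⟩
  intro x hx
  by_contra hxK
  have : x ∈ insert q Y \ K :=
    Finset.mem_sdiff.2 ⟨Finset.mem_insert_of_mem (Finset.mem_of_mem_erase hx), hxK⟩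
  rw [ha, Finset.mem_singleton] at this
  exact Finset.ne_of_mem_erase hx this

namespace CoredCliqueSystem

variable {k : ℕ} {V : Type*} [DecidableEq V] {H : SimpleGraph V} {F : Finset (Finset V)}
  {Y : Finset V}

lemma exists_eq_insert_insert (h : CoredCliqueSystem k H F Y) {S : Finset V} (hS : S ∈ F) :
    ∃ p q, p ≠ q ∧ p ∉ Y ∧ q ∉ Y ∧ S = insert p (insert q Y) := by
  obtain ⟨p, q, hpq, he⟩ := Finset.card_eq_two.1 (h.card_sdiff hS)
  have hp : p ∈ S \ Y := by simp [he]
  have hq : q ∈ S \ Y := by simp [he]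
  refine ⟨p, q, hpq, (Finset.mem_sdiff.1 hp).2, (Finset.mem_sdiff.1 hq).2, ?_⟩
  rw [← Finset.sdiff_union_of_subset (h.core_subset S hS), he]
  ext x
  simp

/-- Vertices of a member that are complete to the core up to a common vertex are not adjacent. -/
lemma not_adj_of_complete (h : CoredCliqueSystem k H F Y) {S : Finset V} (hS : S ∈ F)
    {a p q : V} (ha : a ∈ Y) (hp : p ∈ S) (hq : q ∈ S) (hpa : ∀ y ∈ Y.erase a, H.Adj p y)
    (hqa : ∀ y ∈ Y.erase a, H.Adj q y) : ¬ H.Adj p q := by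
  intro hpq
  have h1 : H.IsNClique (k + 1 - 1) (Y.erase a) := h.core_isNClique.erase_of_mem ha
  have h2 := (h1.insert hqa).insert (a := p) (fun b hb => by
    rcases Finset.mem_insert.1 hb with rfl | hb
    · exact hpq
    · exact hpa b hb)
  exact h.not_clique S hS _ (Finset.insert_subset hp (Finset.insert_subset hq
    ((Finset.erase_subset _ _).trans (h.core_subset S hS)))) h2

/-- In a large system some member consists of the core and two vertices that are complete to the
core up to a common vertex. -/
lemma exists_complete_pair (h : CoredCliqueSystem k H F Y)
    (hF : 2 ^ (k + 1) * (k + 3) * (k + 3) * (k + 2) < F.card) :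
    ∃ S ∈ F, ∃ p q a, a ∈ Y ∧ p ∉ Y ∧ q ∉ Y ∧ S = insert p (insert q Y) ∧
      (∀ y ∈ Y.erase a, H.Adj p y) ∧ (∀ y ∈ Y.erase a, H.Adj q y) := by
  classical
  obtain ⟨M, hMF, hM, hMd⟩ := h.exists_sunflower _ hF
  have hl := fun S (hS : S ∈ F) => h.exists_eq_insert_insert hS
  have : Nonempty V :=
    ⟨(Finset.card_pos.1 (show 0 < Y.card by rw [h.core_isNClique.2]; omega)).choose⟩
  choose! p q hpq hpY hqY hS using hl
  obtain ⟨c, -, hc⟩ := Finset.exists_le_card_fiber_of_mul_le_card_of_maps_to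
    (s := M) (t := Y.powerset) (f := fun S => Y.filter (H.Adj (p S))) (n := k + 3)
    (fun S _ => Finset.mem_powerset.2 (Finset.filter_subset _ _))
    ⟨∅, Finset.empty_mem_powerset _⟩
    (by rw [Finset.card_powerset, h.core_isNClique.2, hM])
  set G := M.filter (fun S => Y.filter (H.Adj (p S)) = c) with hG
  have hGM : ∀ S ∈ G, S ∈ M := fun S hS => (Finset.mem_filter.1 hS).1
  have hGc : ∀ S ∈ G, ∀ T ∈ G, ∀ y ∈ Y, H.Adj (p S) y → H.Adj (p T) y := by
    intro S hS T hT y hy hadj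
    have : y ∈ Y.filter (H.Adj (p S)) := Finset.mem_filter.2 ⟨hy, hadj⟩
    rw [(Finset.mem_filter.1 hS).2, ← (Finset.mem_filter.1 hT).2] at this
    exact (Finset.mem_filter.1 this).2
  have hpS : ∀ S ∈ G, p S ∈ S := fun S hS' =>
    (Finset.ext_iff.1 (hS S (hMF (hGM S hS'))) _).2 (Finset.mem_insert_self _ _)
  have hpT : ∀ S ∈ G, ∀ T ∈ G, S ≠ T → p S ∉ T := fun S hS' T hT hne hpT =>
    hpY S (hMF (hGM S hS')) (hMd S (hGM S hS') T (hGM T hT) hne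
      (Finset.mem_inter.2 ⟨hpS S hS', hpT⟩))
  obtain ⟨S, hSG, T, hTG, hne, hST⟩ : ∃ S ∈ G, ∃ T ∈ G, S ≠ T ∧ ¬ H.Adj (p S) (p T) := by
    by_contra! hadj
    have hfree := h.cliqueFree.mono hc
    refine hfree (G.image p) ⟨?_, Finset.card_image_of_injOn ?_⟩
    · intro u hu v hv huv
      simp only [Finset.coe_image, Set.mem_image, Finset.mem_coe] at hu hv
      obtain ⟨S, hS, rfl⟩ := hu
      obtain ⟨T, hT, rfl⟩ := hv
      exact hadj S hS T hT (by rintro rfl; exact huv rfl)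
    · intro S hS' T hT hST
      by_contra hne
      exact hpT S hS' T hT hne (hST ▸ hpS T hT)
  have hSF := hMF (hGM S hSG)
  have hTF := hMF (hGM T hTG)
  obtain ⟨K, hK, hKc, hKadj⟩ := h.dominating T hTF _ (hpT S hSG T hTG hne)
  have hKT := hK
  rw [hS T hTF] at hK
  obtain ⟨hqK, a, ha, haK⟩ := exists_erase_subset_of_notMem hK
    (hKc.2.trans h.core_isNClique.2.symm) (hqY T hTF) (fun hp => hST (hKadj _ hp)) (by
      rintro rfl
      obtain ⟨y, hy, hyn⟩ := h.exists_not_adj hSF (hpS S hSG)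
      exact hyn (hKadj y hy))
  refine ⟨T, hTF, p T, q T, a, ha, hpY T hTF, hqY T hTF, hS T hTF, fun y hy => ?_,
    fun y hy => ?_⟩
  · exact hGc S hSG T hTG y (Finset.mem_of_mem_erase hy) (hKadj y (haK hy))
  · refine hKc.1 hqK (haK hy) ?_
    rintro rfl
    exact hqY T hTF (Finset.mem_of_mem_erase hy)

/-- In a large system a single core vertex is missed by every vertex outside the core, all other
adjacencies to the core being present. -/
lemma exists_missed (h : CoredCliqueSystem k H F Y)
    (hF : 2 ^ (k + 1) * (k + 3) * (k + 3) * (k + 2) < F.card) :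
    ∃ a ∈ Y, ∀ S ∈ F, ∀ u ∈ S, u ∉ Y → ∀ y ∈ Y.erase a, H.Adj u y := by
  obtain ⟨S, hS, p, q, a, ha, hpY, hqY, rfl, hp, hq⟩ := h.exists_complete_pair hF
  refine ⟨a, ha, fun T hT u hu huY => ?_⟩
  by_cases huS : u ∈ insert p (insert q Y)
  · rcases Finset.mem_insert.1 huS with rfl | huS
    · exact hp
    · rcases Finset.mem_insert.1 huS with rfl | huS
      · exact hq
      · exact absurd huS huY
  have hpS : p ∈ insert p (insert q Y) := Finset.mem_insert_self _ _
  have hqS : q ∈ insert p (insert q Y) := Finset.mem_insert_of_mem (Finset.mem_insert_self _ _)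
  have hpq := h.not_adj_of_complete hS ha hpS hqS hp hq
  obtain ⟨K, hK, hKc, hKadj⟩ := h.dominating _ hS u huS
  have hKY : K ≠ Y := by
    rintro rfl
    obtain ⟨y, hy, hyn⟩ := h.exists_not_adj hT hu
    exact hyn (hKadj y hy)
  have main : ∀ p q, q ∉ Y → q ∈ insert p (insert q Y) → insert p (insert q Y) ∈ F →
      (∀ y ∈ Y.erase a, H.Adj q y) → K ⊆ insert p (insert q Y) → p ∉ K →
      ∀ y ∈ Y.erase a, H.Adj u y := by
    intro p q hqY hqS hS hq hK hpK y hy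
    obtain ⟨hqK, b, hb, hbK⟩ := exists_erase_subset_of_notMem hK
      (hKc.2.trans h.core_isNClique.2.symm) hqY hpK hKY
    have hba : b = a := by
      by_contra hba
      obtain ⟨z, hz, hzn⟩ := h.exists_not_adj hS hqS
      by_cases hza : z = a
      · subst hza
        exact hzn (hKc.1 hqK (hbK (Finset.mem_erase.2 ⟨Ne.symm hba, hz⟩))
          (by rintro rfl; exact hqY hz))
      · exact hzn (hq z (Finset.mem_erase.2 ⟨hza, hz⟩))
    subst hba
    exact hKadj y (hbK hy)
  by_cases hpK : p ∈ K
  · have hqK : q ∉ K := fun hqK => by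
      by_cases hpq' : p = q
      · subst hpq'
        have := h.card_sdiff hS
        rw [Finset.insert_idem, Finset.insert_sdiff_of_notMem _ hpY] at this
        simp at this
      · exact hpq (hKc.1 hpK hqK hpq')
    rw [Finset.insert_comm] at hpS hS hK
    exact main q p hpY hpS hS hp hK hqK
  · exact main p q hqY hqS hS hq hK hpK

end CoredCliqueSystem

/-- A cored clique system in which all vertices outside the core miss the same core vertex `a`
and are adjacent to the rest of the core. -/
structure UniformCliqueSystem (k : ℕ) {V : Type*} [DecidableEq V] (H : SimpleGraph V)
    (F : Finset (Finset V)) (Y : Finset V) (a : V) : Prop extends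
    CoredCliqueSystem k H F Y where
  missed_mem : a ∈ Y
  adj_core : ∀ S ∈ F, ∀ u ∈ S, u ∉ Y → ∀ y ∈ Y.erase a, H.Adj u y

namespace UniformCliqueSystem

variable {k : ℕ} {V : Type*} [DecidableEq V] {H : SimpleGraph V} {F : Finset (Finset V)}
  {Y : Finset V} {a : V}

lemma not_adj (h : UniformCliqueSystem k H F Y a) {S : Finset V} (hS : S ∈ F) {u v : V}
    (hu : u ∈ S) (hv : v ∈ S) (huY : u ∉ Y) (hvY : v ∉ Y) : ¬ H.Adj u v :=
  h.not_adj_of_complete hS h.missed_mem hu hv (h.adj_core S hS u hu huY)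
    (h.adj_core S hS v hv hvY)

lemma exists_adj (h : UniformCliqueSystem k H F Y a) {S T : Finset V} (hS : S ∈ F)
    (hT : T ∈ F) {u : V} (hu : u ∈ S) (huT : u ∉ T) : ∃ x ∈ T, x ∉ Y ∧ H.Adj u x := by
  obtain ⟨K, hK, hKc, hKadj⟩ := h.dominating T hT u huT
  by_contra! hc
  have hKY : K ⊆ Y := fun x hx => by
    by_contra hxY
    exact hc x (hK hx) hxY (hKadj x hx)
  have := Finset.eq_of_subset_of_card_le hKY (by rw [hKc.2, h.core_isNClique.2])
  subst this
  obtain ⟨y, hy, hyn⟩ := h.exists_not_adj hS hu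
  exact hyn (hKadj y hy)

lemma triangle_free (h : UniformCliqueSystem k H F Y a) {S T R : Finset V} (hS : S ∈ F)
    (hT : T ∈ F) (hR : R ∈ F) {u v w : V} (hu : u ∈ S) (hv : v ∈ T) (hw : w ∈ R)
    (huY : u ∉ Y) (hvY : v ∉ Y) (hwY : w ∉ Y) (huv : H.Adj u v) (huw : H.Adj u w) :
    ¬ H.Adj v w := by
  intro hvw
  have h1 : H.IsNClique (k + 1 - 1) (Y.erase a) := h.core_isNClique.erase_of_mem h.missed_mem
  have h2 := h1.insert (h.adj_core R hR w hw hwY)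
  have h3 := h2.insert (a := v) fun b hb => by
    rcases Finset.mem_insert.1 hb with rfl | hb
    · exact hvw
    · exact h.adj_core T hT v hv hvY b hb
  have h4 := h3.insert (a := u) fun b hb => by
    rcases Finset.mem_insert.1 hb with rfl | hb
    · exact huv
    rcases Finset.mem_insert.1 hb with rfl | hb
    · exact huw
    · exact h.adj_core S hS u hu huY b hb
  exact h.cliqueFree _ h4

lemma exists_other (h : UniformCliqueSystem k H F Y a) {S : Finset V} (hS : S ∈ F) {b : V}
    (hb : b ∈ S) (hbY : b ∉ Y) : ∃ c ∈ S, c ∉ Y ∧ ∀ x ∈ S, x ∉ Y → x = b ∨ x = c := by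
  obtain ⟨p, q, hpq, hp, hq, rfl⟩ := h.exists_eq_insert_insert hS
  simp only [Finset.mem_insert] at hb
  rcases hb with rfl | rfl | hb
  · exact ⟨q, by simp, hq, by simp; tauto⟩
  · exact ⟨p, by simp, hp, by simp; tauto⟩
  · exact absurd hb hbY

/-- Distinct members of a large uniform system meet only in the core. -/
lemma inter_subset (h : UniformCliqueSystem k H F Y a) (hF : (k + 6) * (k + 2) < F.card)
    {S T : Finset V} (hS : S ∈ F) (hT : T ∈ F) (hne : S ≠ T) : S ∩ T ⊆ Y := by
  intro b hb
  by_contra hbY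
  obtain ⟨hbS, hbT⟩ := Finset.mem_inter.1 hb
  obtain ⟨c, hcS, hcY, hc⟩ := h.exists_other hS hbS hbY
  obtain ⟨d, hdT, hdY, hd⟩ := h.exists_other hT hbT hbY
  have hcT : c ∉ T := by
    intro hcT
    refine hne (Finset.eq_of_subset_of_card_le (fun x hx => ?_)
      (by rw [h.card_eq S hS, h.card_eq T hT]))
    by_cases hxY : x ∈ Y
    · exact h.core_subset T hT hxY
    · rcases hc x hx hxY with rfl | rfl <;> assumption
  have hcd : H.Adj c d := by
    obtain ⟨x, hxT, hxY, hx⟩ := h.exists_adj hS hT hcS hcT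
    rcases hd x hxT hxY with rfl | rfl
    · exact absurd hx (h.not_adj hS hcS hbS hcY hbY)
    · exact hx
  have key : ∀ R ∈ F, ∀ v ∈ R, v ∉ Y → v ∉ ({b, c, d} : Finset V) → H.Adj b v := by
    intro R hR v hv hvY hvn
    simp only [Finset.mem_insert, Finset.mem_singleton, not_or] at hvn
    obtain ⟨x, hxS, hxY, hx⟩ := h.exists_adj hR hS hv fun hvS => by
      rcases hc v hvS hvY with rfl | rfl <;> simp at hvn
    obtain ⟨z, hzT, hzY, hz⟩ := h.exists_adj hR hT hv fun hvT => by
      rcases hd v hvT hvY with rfl | rfl <;> simp at hvn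
    rcases hc x hxS hxY with rfl | rfl
    · exact hx.symm
    rcases hd z hzT hzY with rfl | rfl
    · exact hz.symm
    exact absurd hcd (h.triangle_free hR hS hT hv hxS hzT hvY hxY hzY hx hz)
  have h3 : ({b, c, d} : Finset V).card ≤ 3 := Finset.card_le_three
  obtain ⟨R, hR, hRa⟩ := h.exists_mem_avoiding {b, c, d}
    (lt_of_le_of_lt (Nat.mul_le_mul_right _ (by omega)) hF)
  obtain ⟨Q, hQ, hQa⟩ := h.exists_mem_avoiding ({b, c, d} ∪ R)
    (lt_of_le_of_lt (Nat.mul_le_mul_right _ ((Finset.card_union_le _ _).trans (by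
      rw [h.card_eq R hR]; omega))) hF)
  obtain ⟨v, w, -, hvY, -, hvw⟩ := h.exists_eq_insert_insert hR
  have hvR : v ∈ R := by simp [hvw]
  obtain ⟨x, hxQ, hxY, hx⟩ := h.exists_adj hR hQ hvR fun hvQ =>
    hvY (hQa v hvQ (Finset.mem_union_right _ hvR))
  exact h.triangle_free hS hR hQ hbS hvR hxQ hbY hvY hxY
    (key R hR v hvR hvY fun hv => hvY (hRa v hvR hv))
    (key Q hQ x hxQ hxY fun hx => hxY (hQa x hxQ (Finset.mem_union_left _ hx))) hx

end UniformCliqueSystem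

namespace UniformCliqueSystem

variable {k : ℕ} {V : Type*} [DecidableEq V] {H : SimpleGraph V} {F : Finset (Finset V)}
  {Y : Finset V} {a : V}

/-- Edge count for a uniform system whose members meet only in the core. -/
lemma le_two_mul_card_edges [Fintype V] (h : UniformCliqueSystem k H F Y a)
    (hd : ∀ S ∈ F, ∀ T ∈ F, S ≠ T → S ∩ T ⊆ Y) :
    k * (k + 2 * F.card) + k + 2 * F.card * (k + (F.card - 1)) ≤ 2 * H.edgeSet.ncard := by
  classical
  set W := F.biUnion (· \ Y) with hW
  have hWY : Disjoint Y W := by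
    simp only [hW, Finset.disjoint_biUnion_right]
    exact fun S _ => Finset.disjoint_sdiff
  have hdisj : (F : Set (Finset V)).PairwiseDisjoint (· \ Y) := by
    intro S hS T hT hne
    refine Finset.disjoint_left.2 fun x hxS hxT => ?_
    rw [Finset.mem_sdiff] at hxS hxT
    exact hxS.2 (hd S hS T hT hne (Finset.mem_inter.2 ⟨hxS.1, hxT.1⟩))
  have hWc : W.card = 2 * F.card := by
    rw [hW, Finset.card_biUnion hdisj, Finset.sum_congr rfl fun S hS => h.card_sdiff hS]
    simp [mul_comm]
  have hWadj : ∀ w ∈ W, ∀ y ∈ Y.erase a, H.Adj w y := by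
    intro w hw
    obtain ⟨S, hS, hwS⟩ := Finset.mem_biUnion.1 hw
    exact h.adj_core S hS w (Finset.mem_sdiff.1 hwS).1 (Finset.mem_sdiff.1 hwS).2
  have hYa : (Y.erase a).card = k := by
    rw [Finset.card_erase_of_mem h.missed_mem, h.core_isNClique.2, Nat.add_sub_cancel]
  have hdega : k ≤ H.degree a := by
    rw [← H.card_neighborFinset_eq_degree, ← hYa]
    refine Finset.card_le_card fun y hy => ?_
    rw [mem_neighborFinset]
    exact h.core_isNClique.1 h.missed_mem (Finset.mem_of_mem_erase hy)
      (Finset.ne_of_mem_erase hy).symm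
  have hdegY : ∀ y ∈ Y.erase a, k + 2 * F.card ≤ H.degree y := by
    intro y hy
    have hyY := Finset.mem_of_mem_erase hy
    have hc : (Y.erase y ∪ W).card = k + 2 * F.card := by
      rw [Finset.card_union_of_disjoint (hWY.mono_left (Finset.erase_subset _ _)), hWc,
        Finset.card_erase_of_mem hyY, h.core_isNClique.2, Nat.add_sub_cancel]
    rw [← H.card_neighborFinset_eq_degree, ← hc]
    refine Finset.card_le_card fun z hz => ?_
    rw [mem_neighborFinset]
    rcases Finset.mem_union.1 hz with hz | hz
    · exact h.core_isNClique.1 hyY (Finset.mem_of_mem_erase hz) (Finset.ne_of_mem_erase hz).symm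
    · exact (hWadj z hz y hy).symm
  have hdegW : ∀ w ∈ W, k + (F.card - 1) ≤ H.degree w := by
    intro w hw
    obtain ⟨S, hS, hwS⟩ := Finset.mem_biUnion.1 hw
    rw [Finset.mem_sdiff] at hwS
    have hx : ∀ T ∈ F.erase S, ∃ x ∈ T, x ∉ Y ∧ H.Adj w x := fun T hT =>
      h.exists_adj hS (Finset.mem_of_mem_erase hT) hwS.1 fun hwT => hwS.2
        (hd S hS T (Finset.mem_of_mem_erase hT) (Finset.ne_of_mem_erase hT).symm
          (Finset.mem_inter.2 ⟨hwS.1, hwT⟩))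
    have : Nonempty V := ⟨w⟩
    choose! f hfT hfY hf using hx
    have hfc : ((F.erase S).image f).card = F.card - 1 := by
      rw [Finset.card_image_of_injOn, Finset.card_erase_of_mem hS]
      intro T hT R hR hTR
      by_contra hne
      exact hfY T hT (hd T (Finset.mem_of_mem_erase hT) R (Finset.mem_of_mem_erase hR) hne
        (Finset.mem_inter.2 ⟨hfT T hT, hTR ▸ hfT R hR⟩))
    have hc : (Y.erase a ∪ (F.erase S).image f).card = k + (F.card - 1) := by
      rw [Finset.card_union_of_disjoint, hYa, hfc]
      refine Finset.disjoint_left.2 fun x hxY hxf => ?_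
      obtain ⟨T, hT, rfl⟩ := Finset.mem_image.1 hxf
      exact hfY T hT (Finset.mem_of_mem_erase hxY)
    rw [← H.card_neighborFinset_eq_degree, ← hc]
    refine Finset.card_le_card fun z hz => ?_
    rw [mem_neighborFinset]
    rcases Finset.mem_union.1 hz with hz | hz
    · exact hWadj w hw z hz
    · obtain ⟨T, hT, rfl⟩ := Finset.mem_image.1 hz
      exact hf T hT
  have hsum : ∑ v ∈ Y ∪ W, H.degree v ≤ 2 * H.edgeSet.ncard := by
    rw [Set.ncard_eq_toFinset_card', ← edgeFinset, ← H.sum_degrees_eq_twice_card_edges]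
    exact Finset.sum_le_sum_of_subset (Finset.subset_univ _)
  rw [Finset.sum_union hWY, ← Finset.sum_erase_add _ _ h.missed_mem] at hsum
  have h1 := Finset.card_nsmul_le_sum _ _ _ hdegY
  have h2 := Finset.card_nsmul_le_sum _ _ _ hdegW
  rw [hYa, smul_eq_mul] at h1
  rw [hWc, smul_eq_mul] at h2
  omega

end UniformCliqueSystem

/-- The number of members beyond which a `(k + 3, k + 3)`-system is forced to be a sunflower. -/
def largeSystemBound (k : ℕ) : ℕ :=
  2 ^ (k + 3) * ((k + 3) * (k + 2)) + 2 ^ (k + 1) * (k + 3) * (k + 3) * (k + 2) +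
    (k + 6) * (k + 2) + 2

lemma CliqueSystem.le_two_mul_card_edges {k : ℕ} {V : Type*} [DecidableEq V] [Fintype V]
    {H : SimpleGraph V} {F : Finset (Finset V)} (h : CliqueSystem k H F)
    (hF : largeSystemBound k ≤ F.card) :
    k * (k + 2 * F.card) + k + 2 * F.card * (k + (F.card - 1)) ≤ 2 * H.edgeSet.ncard := by
  unfold largeSystemBound at hF
  obtain ⟨Y, hYc, hYF⟩ := h.exists_core (by omega)
  have hc : CoredCliqueSystem k H F Y := ⟨h, hYc, hYF⟩
  obtain ⟨a, ha, hadj⟩ := hc.exists_missed (by omega)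
  have hu : UniformCliqueSystem k H F Y a := ⟨hc, ha, hadj⟩
  exact hu.le_two_mul_card_edges fun S hS T hT hne => hu.inter_subset (by omega) hS hT hne

/-- The join of a complete graph on `k` vertices with the disjoint union of an isolated vertex
and a complete bipartite graph `K_{s,s}` minus a perfect matching. -/
def extremalGraph (k s : ℕ) : SimpleGraph (Fin (2 * s + 1 + k)) where
  Adj x y := x ≠ y ∧ (2 * s < x.val ∨ 2 * s < y.val ∨
    (x.val < 2 * s ∧ y.val < 2 * s ∧ x.val / 2 ≠ y.val / 2 ∧ x.val % 2 ≠ y.val % 2))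
  symm := ⟨fun x y h => by
    refine ⟨h.1.symm, ?_⟩
    have := h.2
    omega⟩
  loopless := ⟨fun x h => h.1 rfl⟩

namespace extremalGraph

variable {k s : ℕ}

/-- The vertices of the complete part. -/
def apex (k s : ℕ) : Finset (Fin (2 * s + 1 + k)) :=
  Finset.univ.filter fun x => 2 * s < x.val

/-- The isolated vertex of the bipartite part. -/
def center (k s : ℕ) : Fin (2 * s + 1 + k) := ⟨2 * s, by omega⟩

/-- The complete part, the isolated vertex and a pair of the removed matching. -/
def member (k s : ℕ) (i : ℕ) : Finset (Fin (2 * s + 1 + k)) :=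
  Finset.univ.filter fun x => 2 * s ≤ x.val ∨ x.val / 2 = i

/-- The family of all members. -/
def family (k s : ℕ) : Finset (Finset (Fin (2 * s + 1 + k))) :=
  (Finset.range s).image (member k s)

lemma mem_apex {x : Fin (2 * s + 1 + k)} : x ∈ apex k s ↔ 2 * s < x.val := by simp [apex]

lemma mem_member {i : ℕ} {x : Fin (2 * s + 1 + k)} :
    x ∈ member k s i ↔ 2 * s ≤ x.val ∨ x.val / 2 = i := by simp [member]

lemma card_apex : (apex k s).card = k := by
  have : apex k s = Finset.univ.map (Fin.natAddEmb (m := k) (2 * s + 1)) := by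
    ext x
    simp only [mem_apex, Finset.mem_map, Finset.mem_univ, true_and, Fin.natAddEmb_apply]
    constructor
    · intro hx
      exact ⟨⟨x.val - (2 * s + 1), by omega⟩, Fin.ext (by simp; omega)⟩
    · rintro ⟨y, rfl⟩
      simp
      omega
  rw [this, Finset.card_map, Finset.card_univ, Fintype.card_fin]

lemma isNClique_apex : (extremalGraph k s).IsNClique k (apex k s) :=
  ⟨fun _ hx _ _ hne => ⟨hne, Or.inl (mem_apex.1 hx)⟩, card_apex⟩

lemma adj_of_mem_apex {x y : Fin (2 * s + 1 + k)} (hy : y ∈ apex k s) (hx : x.val ≤ 2 * s) :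
    (extremalGraph k s).Adj x y := by
  rw [mem_apex] at hy
  exact ⟨by rintro rfl; omega, Or.inr (Or.inl hy)⟩

lemma isNClique_insert_apex {G : SimpleGraph (Fin (2 * s + 1 + k))} (hG : extremalGraph k s ≤ G)
    {x : Fin (2 * s + 1 + k)} (hx : x.val ≤ 2 * s) :
    G.IsNClique (k + 1) (insert x (apex k s)) :=
  (isNClique_apex.mono hG).insert fun _ hb => hG (adj_of_mem_apex hb hx)

lemma isNClique_insert_insert_apex {G : SimpleGraph (Fin (2 * s + 1 + k))}
    (hG : extremalGraph k s ≤ G) {x y : Fin (2 * s + 1 + k)} (hx : x.val ≤ 2 * s)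
    (hy : y.val ≤ 2 * s) (hxy : G.Adj x y) :
    G.IsNClique (k + 2) (insert x (insert y (apex k s))) :=
  (isNClique_insert_apex hG hy).insert fun b hb => by
    rcases Finset.mem_insert.1 hb with rfl | hb
    · exact hxy
    · exact hG (adj_of_mem_apex hb hx)

lemma cliqueFree : (extremalGraph k s).CliqueFree (k + 3) := by
  refine Colorable.cliqueFree (n := k + 2) ⟨Coloring.mk (fun x => if x.val < 2 * s then
    (⟨x.val % 2, by omega⟩ : Fin (k + 2)) else if x.val = 2 * s then ⟨0, by omega⟩ else
    ⟨x.val - 2 * s + 1, by omega⟩) ?_⟩ (by omega)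
  rintro x y ⟨hne, h⟩
  rw [Ne, Fin.ext_iff] at hne
  split_ifs <;> simp only [ne_eq, Fin.mk.injEq] <;> omega

lemma induce_member_cliqueFree (i : ℕ) :
    ((extremalGraph k s).induce (member k s i : Set (Fin (2 * s + 1 + k)))).CliqueFree
      (k + 2) := by
  refine Colorable.cliqueFree (n := k + 1) ⟨Coloring.mk
    (fun x => (⟨x.1.val - 2 * s, by omega⟩ : Fin (k + 1))) ?_⟩ (by omega)
  rintro ⟨x, hx⟩ ⟨y, hy⟩ ⟨hne, h⟩
  rw [Ne, Fin.ext_iff] at hne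
  rw [Finset.mem_coe, mem_member] at hx hy
  simp only [ne_eq, Fin.mk.injEq, Function.Embedding.subtype_apply] at h hne ⊢
  omega

lemma apex_subset_member {i : ℕ} : apex k s ⊆ member k s i := fun x hx => by
  rw [mem_apex] at hx
  exact mem_member.2 (Or.inl hx.le)

lemma center_mem_member {i : ℕ} : center k s ∈ member k s i :=
  mem_member.2 (Or.inl le_rfl)

lemma card_member {i : ℕ} (hi : i < s) : (member k s i).card = k + 3 := by
  have : member k s i = insert ⟨2 * i, by omega⟩ (insert ⟨2 * i + 1, by omega⟩
      (insert (center k s) (apex k s))) := by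
    ext x
    simp only [mem_member, Finset.mem_insert, mem_apex, Fin.ext_iff, center]
    omega
  rw [this, Finset.card_insert_of_notMem, Finset.card_insert_of_notMem,
    Finset.card_insert_of_notMem, card_apex] <;>
  simp only [Finset.mem_insert, mem_apex, Fin.ext_iff, center] <;> omega

lemma card_family : (family k s).card = s := by
  rw [family, Finset.card_image_of_injOn, Finset.card_range]
  intro i hi j hj hij
  rw [Finset.mem_coe, Finset.mem_range] at hi hj
  have : (⟨2 * i, by omega⟩ : Fin (2 * s + 1 + k)) ∈ member k s j :=
    hij ▸ mem_member.2 (Or.inr (by simp))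
  rw [mem_member] at this
  simp at this
  omega

lemma isRTSystem : IsRTSystem (k + 3) (k + 3) (extremalGraph k s) (family k s) := by
  refine ⟨cliqueFree, fun S hS => ?_, fun S hS T hT _ => ?_⟩
  · obtain ⟨i, hi, rfl⟩ := Finset.mem_image.1 hS
    rw [Finset.mem_range] at hi
    refine ⟨card_member hi, induce_member_cliqueFree i, fun v hv => ?_⟩
    rw [mem_member] at hv
    rw [not_cliqueFree_induce_coe]
    have hw : ∃ w : Fin (2 * s + 1 + k), w.val / 2 = i ∧ w.val % 2 ≠ v.val % 2 ∧
        w.val < 2 * s := ⟨⟨2 * i + (1 - v.val % 2), by omega⟩, by simp; omega⟩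
    obtain ⟨w, hwi, hwv, hws⟩ := hw
    refine ⟨insert v (insert w (apex k s)), Finset.insert_subset_insert _
      (Finset.insert_subset (mem_member.2 (Or.inr hwi)) apex_subset_member),
      isNClique_insert_insert_apex le_rfl (by omega) hws.le ⟨?_, by omega⟩⟩
    rintro rfl
    exact hwv rfl
  · obtain ⟨i, -, rfl⟩ := Finset.mem_image.1 hS
    obtain ⟨j, -, rfl⟩ := Finset.mem_image.1 hT
    rw [not_cliqueFree_induce_coe]
    exact ⟨insert (center k s) (apex k s), Finset.subset_inter
      (Finset.insert_subset center_mem_member apex_subset_member)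
      (Finset.insert_subset center_mem_member apex_subset_member),
      isNClique_insert_apex le_rfl le_rfl⟩

lemma isMaxRTSystem (hs : 3 ≤ s) :
    IsMaxRTSystem (k + 3) (k + 3) (extremalGraph k s) (family k s) := by
  refine ⟨isRTSystem, fun u v huv hadj => ?_⟩
  set G := extremalGraph k s ⊔ fromEdgeSet {s(u, v)} with hG
  have hle : extremalGraph k s ≤ G := le_sup_left
  have hGuv : G.Adj u v := by simp [hG, huv]
  have hn := not_and.1 hadj huv
  have hus : u.val ≤ 2 * s := by omega
  have hvs : v.val ≤ 2 * s := by omega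
  have huv' : u.val ≠ v.val := fun h => huv (Fin.ext h)
  by_cases hm : ∃ i < s, u ∈ member k s i ∧ v ∈ member k s i
  · obtain ⟨i, hi, hu, hv⟩ := hm
    refine Or.inr ⟨member k s i, Finset.mem_image_of_mem _ (Finset.mem_range.2 hi), ?_⟩
    rw [not_cliqueFree_induce_coe]
    exact ⟨_, Finset.insert_subset hu (Finset.insert_subset hv apex_subset_member),
      isNClique_insert_insert_apex hle hus hvs hGuv⟩
  · simp only [mem_member] at hm
    push Not at hm
    have hu : u.val < 2 * s := by
      by_contra hu
      have := hm (if v.val < 2 * s then v.val / 2 else 0) (by split_ifs <;> omega) (by omega)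
      split_ifs at this <;> omega
    have hv : v.val < 2 * s := by
      by_contra hv
      have := hm (u.val / 2) (by omega) (by omega)
      omega
    have hne : u.val / 2 ≠ v.val / 2 := fun h => by
      have := hm (u.val / 2) (by omega) (by omega)
      omega
    have hpar : u.val % 2 = v.val % 2 := by omega
    obtain ⟨j, hj, hju, hjv⟩ : ∃ j < s, j ≠ u.val / 2 ∧ j ≠ v.val / 2 := by
      by_contra! h
      have h0 := h 0 (by omega)
      have h1 := h 1 (by omega)
      have h2 := h 2 (by omega)
      omega
    obtain ⟨w, hw⟩ : ∃ w : Fin (2 * s + 1 + k), w.val = 2 * j + (1 - u.val % 2) :=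
      ⟨⟨2 * j + (1 - u.val % 2), by omega⟩, rfl⟩
    have hwu : (extremalGraph k s).Adj w u := ⟨by rintro rfl; omega, by omega⟩
    have hwv : (extremalGraph k s).Adj w v := ⟨by rintro rfl; omega, by omega⟩
    refine Or.inl (IsNClique.not_cliqueFree (s := insert w (insert u (insert v (apex k s))))
      ((isNClique_insert_insert_apex hle hus hvs hGuv).insert fun b hb => ?_))
    rcases Finset.mem_insert.1 hb with rfl | hb
    · exact hle hwu
    rcases Finset.mem_insert.1 hb with rfl | hb
    · exact hle hwv
    · exact hle (adj_of_mem_apex hb (by omega))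

lemma two_mul_card_edges_le : 2 * (extremalGraph k s).edgeSet.ncard ≤
    k * (k + 2 * s) + k + 2 * s * (k + (s - 1)) := by
  classical
  rw [Set.ncard_eq_toFinset_card', ← edgeFinset, ← sum_degrees_eq_twice_card_edges,
    Fin.sum_univ_add, Fin.sum_univ_castSucc]
  have h1 : ∀ x : Fin k, (extremalGraph k s).degree (Fin.natAdd (2 * s + 1) x) ≤ k + 2 * s := by
    intro x
    have := (extremalGraph k s).degree_lt_card_verts (Fin.natAdd (2 * s + 1) x)
    rw [Fintype.card_fin] at this
    omega
  have h2 : (extremalGraph k s).degree (Fin.castAdd k (Fin.last (2 * s))) ≤ k := by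
    rw [← card_neighborFinset_eq_degree]
    refine (Finset.card_le_card fun y hy => ?_).trans (card_apex (s := s)).le
    obtain ⟨-, hy⟩ := (mem_neighborFinset _ _ _).1 hy
    simp only [Fin.val_castAdd, Fin.val_last] at hy
    rw [mem_apex]
    omega
  have h3 : ∀ x : Fin (2 * s),
      (extremalGraph k s).degree (Fin.castAdd k x.castSucc) ≤ k + (s - 1) := by
    intro x
    have hx := x.2
    have hlt : ∀ j, j < s → 2 * j + (1 - x.val % 2) < 2 * s + 1 + k := fun j hj => by omega
    let f : ℕ → Fin (2 * s + 1 + k) := fun j =>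
      if hj : j < s then ⟨2 * j + (1 - x.val % 2), hlt j hj⟩ else center k s
    have hsub : (extremalGraph k s).neighborFinset (Fin.castAdd k x.castSucc) ⊆
        apex k s ∪ ((Finset.range s).erase (x.val / 2)).image f := by
      intro y hy
      obtain ⟨-, hy⟩ := (mem_neighborFinset _ _ _).1 hy
      simp only [Fin.val_castAdd, Fin.val_castSucc] at hy
      rw [Finset.mem_union, mem_apex]
      refine or_iff_not_imp_left.2 fun hys => Finset.mem_image.2 ⟨y.val / 2, ?_, ?_⟩
      · rw [Finset.mem_erase, Finset.mem_range]
        omega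
      · have hys' : y.val / 2 < s := by omega
        simp only [f, hys', dif_pos, Fin.ext_iff]
        omega
    rw [← card_neighborFinset_eq_degree]
    refine (Finset.card_le_card hsub).trans ((Finset.card_union_le _ _).trans ?_)
    rw [card_apex]
    gcongr
    refine Finset.card_image_le.trans ?_
    rw [Finset.card_erase_of_mem (Finset.mem_range.2 (by omega)), Finset.card_range]
  have e1 := Finset.sum_le_card_nsmul Finset.univ _ _ fun x _ => h1 x
  have e3 := Finset.sum_le_card_nsmul Finset.univ _ _ fun x _ => h3 x
  rw [Finset.card_univ, Fintype.card_fin, smul_eq_mul] at e1 e3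
  omega

end extremalGraph

lemma two_mul_edge_formula (k s : ℕ) (hs : 1 ≤ s) :
    2 * ((s : ℤ) ^ 2 + (2 * ((k + 3 : ℕ) : ℤ) - 7) * s +
      (((k + 3 : ℕ) : ℤ) - 2) * (((k + 3 : ℕ) : ℤ) - 3) / 2) =
    ((k * (k + 2 * s) + k + 2 * s * (k + (s - 1)) : ℕ) : ℤ) := by
  have h1 : (((k + 3 : ℕ) : ℤ) - 2) * (((k + 3 : ℕ) : ℤ) - 3) = k * (k + 1) := by
    push_cast
    ring
  have h2 : 2 * ((k : ℤ) * (k + 1) / 2) = k * (k + 1) :=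
    Int.two_mul_ediv_two_of_even (Int.even_mul_succ_self k)
  rw [h1, mul_add, h2]
  push_cast [hs]
  ring

/-- For `r ≥ 3` and large `s`:
`e_{r,r}(s) = e'_{r,r}(s) = s² + (2r-7)s + (r-2)(r-3)/2`. -/
theorem stmt13 (r : ℕ) (hr : 3 ≤ r) :
    ∃ S₀ : ℕ, ∀ s : ℕ, S₀ ≤ s →
      (∀ (V : Type) [Fintype V] [DecidableEq V] (H : SimpleGraph V) (F : Finset (Finset V)),
        IsRTSystem r r H F → F.card = s →
        (s : ℤ) ^ 2 + (2 * (r : ℤ) - 7) * s + ((r : ℤ) - 2) * ((r : ℤ) - 3) / 2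
          ≤ (H.edgeSet.ncard : ℤ)) ∧
      (∃ (m : ℕ) (H : SimpleGraph (Fin m)) (F : Finset (Finset (Fin m))),
        IsMaxRTSystem r r H F ∧ F.card = s ∧
        (H.edgeSet.ncard : ℤ) =
          (s : ℤ) ^ 2 + (2 * (r : ℤ) - 7) * s + ((r : ℤ) - 2) * ((r : ℤ) - 3) / 2) := by
  obtain ⟨k, rfl⟩ := Nat.exists_eq_add_of_le' hr
  refine ⟨largeSystemBound k + 3, fun s hs => ?_⟩
  have hform := two_mul_edge_formula k s (by omega)
  have lower : ∀ (V : Type) [Fintype V] [DecidableEq V] (H : SimpleGraph V)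
      (F : Finset (Finset V)), IsRTSystem (k + 3) (k + 3) H F → F.card = s →
      k * (k + 2 * s) + k + 2 * s * (k + (s - 1)) ≤ 2 * H.edgeSet.ncard := by
    rintro V _ _ H F h rfl
    exact h.cliqueSystem.le_two_mul_card_edges (by omega)
  refine ⟨fun V _ _ H F h hF => ?_, _, extremalGraph k s, extremalGraph.family k s,
    extremalGraph.isMaxRTSystem (by omega), extremalGraph.card_family, ?_⟩
  · have h1 := Int.ofNat_le.2 (lower V H F h hF)
    rw [← hform, Nat.cast_mul, Nat.cast_ofNat] at h1
    linarith
  · have h1 := lower _ (extremalGraph k s) _ extremalGraph.isRTSystem extremalGraph.card_family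
    have h2 := Int.ofNat_inj.2 (le_antisymm h1 extremalGraph.two_mul_card_edges_le)
    rw [← hform, Nat.cast_mul, Nat.cast_ofNat] at h2
    linarith
end

section
/- For every real ε > 0 there exists an integer S₀ such that for every integer s ≥ S₀: every (3,5)-system (H,F) with |F| = s satisfies e(H) ≥ (2/3 - ε)·s, and there exists a maximal (3,5)-system (H,F) with |F| = s and e(H) ≤ (2 + ε)·s. -/
open SimpleGraph

/-- `G` is a family of independent `r`-sets of `H` such that every vertex of a member has a
neighbour in every member not containing it. -/
structure MutDom {V : Type*} (H : SimpleGraph V) (r : ℕ) (G : Finset (Finset V)) : Prop where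
  card : ∀ S ∈ G, S.card = r
  indep : ∀ S ∈ G, ∀ u ∈ S, ∀ v ∈ S, ¬ H.Adj u v
  dom : ∀ S ∈ G, ∀ T ∈ G, ∀ v ∈ S, v ∉ T → ∃ t ∈ T, H.Adj v t

theorem no_triangle {V : Type*} {H : SimpleGraph V} (h3 : H.CliqueFree 3) {u v w : V}
    (h1 : H.Adj u v) (h2 : H.Adj v w) (h : H.Adj u w) : False := by
  classical
  exact h3 {u, v, w} (is3Clique_triple_iff.2 ⟨h1, h, h2⟩)

theorem eq_triple {V : Type*} [DecidableEq V] {S : Finset V} (hS : S.card = 3) {x y z : V}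
    (hx : x ∈ S) (hy : y ∈ S) (hz : z ∈ S) (hxy : x ≠ y) (hxz : x ≠ z) (hyz : y ≠ z) :
    ∀ w, w ∈ S ↔ w = x ∨ w = y ∨ w = z := by
  have h : ({x, y, z} : Finset V) = S := by
    apply Finset.eq_of_subset_of_card_le
    · intro w; simp; rintro (rfl | rfl | rfl) <;> assumption
    · rw [hS, Finset.card_eq_three.2 ⟨x, y, z, hxy, hxz, hyz, rfl⟩]
  intro w; rw [← h]; simp

theorem exists_third {V : Type*} [DecidableEq V] {S : Finset V} (hS : S.card = 3) {x y : V}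
    (hx : x ∈ S) (hy : y ∈ S) (hxy : x ≠ y) :
    ∃ z ∈ S, z ≠ x ∧ z ≠ y ∧ ∀ w, w ∈ S ↔ w = x ∨ w = y ∨ w = z := by
  have : ¬ S ⊆ {x, y} := fun h => by
    have := (Finset.card_le_card h).trans Finset.card_le_two
    omega
  obtain ⟨z, hz, hz'⟩ := Finset.not_subset.1 this
  simp only [Finset.mem_insert, Finset.mem_singleton, not_or] at hz'
  exact ⟨z, hz, hz'.1, hz'.2, eq_triple hS hx hy hz hxy (Ne.symm hz'.1) (Ne.symm hz'.2)⟩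

section Local

variable {V : Type*} {H : SimpleGraph V} {G : Finset (Finset V)}

/-- `S` owns `v ∈ S` if no other member of `G` meets `S` exactly in `v`. -/
def Owns (G : Finset (Finset V)) (S : Finset V) (v : V) : Prop :=
  S ∈ G ∧ v ∈ S ∧ ∀ T ∈ G, T ≠ S → v ∈ T → ∃ w ∈ S, w ∈ T ∧ w ≠ v

theorem not_owns {S : Finset V} {v : V} (hS : S ∈ G) (hv : v ∈ S) (h : ¬ Owns G S v) :
    ∃ T ∈ G, T ≠ S ∧ v ∈ T ∧ ∀ w ∈ S, w ∈ T → w = v := by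
  unfold Owns at h
  push Not at h
  exact h hS hv

variable [DecidableEq V]

theorem MutDom.exists_hitting {r : ℕ} (hG : MutDom H r G) (h3 : H.CliqueFree 3) (W : Finset V)
    (hW : 2 ^ W.card < G.card) : ∃ P Q : V → Prop,
      (∀ u v, H.Adj u v → P u → P v → False) ∧ (∀ u v, H.Adj u v → Q u → Q v → False) ∧
      (∀ u, P u → Q u → False) ∧
      ∀ S ∈ G, S ⊆ W → (∃ p ∈ S, P p) ∧ ∃ q ∈ S, Q q := by
  obtain ⟨T, hT, T', hT', hne, heq⟩ :=
    Finset.exists_ne_map_eq_of_card_lt_of_maps_to (s := G) (t := W.powerset)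
      (f := fun T => T ∩ W)
      (by rwa [Finset.card_powerset]) (fun T _ => by simp)
  have hns : ¬ T ⊆ T' := fun h => hne (Finset.eq_of_subset_of_card_le h
    (by rw [hG.card _ hT, hG.card _ hT']))
  obtain ⟨t, ht, ht'⟩ := Finset.not_subset.1 hns
  obtain ⟨t', htt, hadj⟩ := hG.dom T hT T' hT' t ht ht'
  have heq' : ∀ w, w ∈ W → (w ∈ T ↔ w ∈ T') := fun w hw => by
    have := Finset.ext_iff.1 heq w
    simpa [hw] using this
  have htW : t ∉ W := fun h => ht' ((heq' t h).1 ht)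
  have htW' : t' ∉ W := fun h => hG.indep T hT t ht t' ((heq' t' h).2 htt) hadj
  refine ⟨H.Adj t, H.Adj t', fun u v h h1 h2 => no_triangle h3 h1 h h2,
    fun u v h h1 h2 => no_triangle h3 h1 h h2, fun u h1 h2 => no_triangle h3 hadj h2 h1, ?_⟩
  exact fun S hS hSW => ⟨hG.dom T hT S hS t ht fun h => htW (hSW h),
    hG.dom T' hT' S hS t' htt fun h => htW' (hSW h)⟩

theorem MutDom.exists_owns (hG : MutDom H 3 G) (h3 : H.CliqueFree 3) (hK : 4096 < G.card)
    {S : Finset V} (hS : S ∈ G) : ∃ v, Owns G S v := by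
  by_contra! hno
  have hT : ∀ v ∈ S, ∃ T ∈ G, T ≠ S ∧ v ∈ T ∧ ∀ w ∈ S, w ∈ T → w = v :=
    fun v hv => not_owns hS hv (hno v)
  choose! T hTG hTne hvT hTS using hT
  have hWc : (S ∪ S.biUnion T).card ≤ 12 := by
    refine (Finset.card_union_le _ _).trans ?_
    have : (S.biUnion T).card ≤ S.card * 3 :=
      Finset.card_biUnion_le_card_mul _ _ _ fun v hv => (hG.card _ (hTG v hv)).le
    rw [hG.card S hS] at this ⊢
    omega
  obtain ⟨P, Q, hP, hQ, hPQ, hit⟩ := hG.exists_hitting h3 (S ∪ S.biUnion T)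
    ((Nat.pow_le_pow_right (by norm_num) hWc).trans_lt (by norm_num; exact hK))
  have hitT : ∀ v ∈ S, (∃ p ∈ T v, P p) ∧ ∃ q ∈ T v, Q q := fun v hv => hit _ (hTG v hv)
    ((Finset.subset_biUnion_of_mem T hv).trans Finset.subset_union_right)
  obtain ⟨⟨x, hx, hPx⟩, ⟨y, hy, hQy⟩⟩ := hit S hS Finset.subset_union_left
  have hxy : x ≠ y := fun h => hPQ x hPx (h ▸ hQy)
  obtain ⟨z, hz, hzx, hzy, hSe⟩ := exists_third (hG.card S hS) hx hy hxy
  obtain ⟨-, a, haX, hQa⟩ := hitT x hx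
  obtain ⟨⟨c, hcY, hPc⟩, -⟩ := hitT y hy
  obtain ⟨⟨e, heZ, hPe⟩, f, hfZ, hQf⟩ := hitT z hz
  have hxa : x ≠ a := fun h => hPQ x hPx (h ▸ hQa)
  have hyc : y ≠ c := fun h => hPQ c hPc (h ▸ hQy)
  have hef : e ≠ f := fun h => hPQ e hPe (h ▸ hQf)
  obtain ⟨b, hbX, hbx, hba, hXe⟩ := exists_third (hG.card _ (hTG x hx)) (hvT x hx) haX hxa
  obtain ⟨d, hdY, hdy, hdc, hYe⟩ := exists_third (hG.card _ (hTG y hy)) (hvT y hy) hcY hyc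
  have iX := hG.indep _ (hTG x hx)
  have iY := hG.indep _ (hTG y hy)
  have iZ := hG.indep _ (hTG z hz)
  have hxX := hvT x hx
  have hyY := hvT y hy
  have hzZ := hvT z hz
  have sX := hTS x hx
  have sY := hTS y hy
  have sZ := hTS z hz
  have domXS := hG.dom _ (hTG x hx) S hS
  have domYS := hG.dom _ (hTG y hy) S hS
  have domZS := hG.dom _ (hTG z hz) S hS
  have domSX := hG.dom S hS _ (hTG x hx)
  have domSY := hG.dom S hS _ (hTG y hy)
  have domSZ := hG.dom S hS _ (hTG z hz)
  have domZX := hG.dom _ (hTG z hz) _ (hTG x hx)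
  have domXY := hG.dom _ (hTG x hx) _ (hTG y hy)
  have domYX := hG.dom _ (hTG y hy) _ (hTG x hx)
  have domYZ := hG.dom _ (hTG y hy) _ (hTG z hz)
  have hs : ∀ {u v}, H.Adj u v → H.Adj v u := fun h => h.symm
  have tri : ∀ u v w, H.Adj u v → H.Adj v w → H.Adj u w → False :=
    fun u v w => no_triangle h3
  have haz : H.Adj a z := by
    obtain ⟨t, ht, h⟩ := domXS a haX (fun h => hxa (sX a h haX).symm)
    rcases (hSe t).1 ht with rfl | rfl | rfl
    · exact (iX _ haX _ hxX h).elim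
    · exact (hQ _ _ h hQa hQy).elim
    · exact h
  have hcz : H.Adj c z := by
    obtain ⟨t, ht, h⟩ := domYS c hcY (fun h => hyc (sY c h hcY).symm)
    rcases (hSe t).1 ht with rfl | rfl | rfl
    · exact (hP _ _ h hPc hPx).elim
    · exact (iY _ hcY _ hyY h).elim
    · exact h
  have hez : e ≠ z := by rintro rfl; exact hP _ _ hcz hPc hPe
  have hfz : f ≠ z := by rintro rfl; exact hQ _ _ haz hQa hQf
  have hZe := eq_triple (hG.card _ (hTG z hz)) heZ hfZ hzZ hef hez hfz
  have hxd : H.Adj x d := by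
    obtain ⟨t, ht, h⟩ := domSY x hx (fun h => hxy (sY x hx h))
    rcases (hYe t).1 ht with rfl | rfl | rfl
    · exact (hG.indep S hS _ hx _ hy h).elim
    · exact (hP _ _ h hPx hPc).elim
    · exact h
  have hyb : H.Adj y b := by
    obtain ⟨t, ht, h⟩ := domSX y hy (fun h => hxy (sX y hy h).symm)
    rcases (hXe t).1 ht with rfl | rfl | rfl
    · exact (hG.indep S hS _ hy _ hx h).elim
    · exact (hQ _ _ h hQy hQa).elim
    · exact h
  have hxf : H.Adj x f := by
    obtain ⟨t, ht, h⟩ := domSZ x hx (fun h => hzx (sZ x hx h).symm)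
    rcases (hZe t).1 ht with rfl | rfl | rfl
    · exact (hP _ _ h hPx hPe).elim
    · exact h
    · exact (hG.indep S hS _ hx _ hz h).elim
  have hye : H.Adj y e := by
    obtain ⟨t, ht, h⟩ := domSZ y hy (fun h => hzy (sZ y hy h).symm)
    rcases (hZe t).1 ht with rfl | rfl | rfl
    · exact h
    · exact (hQ _ _ h hQy hQf).elim
    · exact (hG.indep S hS _ hy _ hz h).elim
  have had : H.Adj a d := by
    have : a ∉ T y := by
      rw [hYe]; rintro (rfl | rfl | rfl)
      · exact hxy (sX _ hy haX).symm
      · exact hPQ _ hPc hQa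
      · exact iX _ hxX _ haX hxd
    obtain ⟨t, ht, h⟩ := domXY a haX this
    rcases (hYe t).1 ht with rfl | rfl | rfl
    · exact (hQ _ _ h hQa hQy).elim
    · exact (tri _ _ _ h hcz haz).elim
    · exact h
  have hcb : H.Adj c b := by
    have : c ∉ T x := by
      rw [hXe]; rintro (rfl | rfl | rfl)
      · exact hxy (sY _ hx hcY)
      · exact hPQ _ hPc hQa
      · exact iY _ hyY _ hcY hyb
    obtain ⟨t, ht, h⟩ := domYX c hcY this
    rcases (hXe t).1 ht with rfl | rfl | rfl
    · exact (hP _ _ h hPc hPx).elim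
    · exact (tri _ _ _ h haz hcz).elim
    · exact h
  have hea : H.Adj e a := by
    have : e ∉ T x := by
      rw [hXe]; rintro (rfl | rfl | rfl)
      · exact hzx (sZ _ hx heZ).symm
      · exact hPQ _ hPe hQa
      · exact hP _ _ hcb hPc hPe
    obtain ⟨t, ht, h⟩ := domZX e heZ this
    rcases (hXe t).1 ht with rfl | rfl | rfl
    · exact (hP _ _ h hPe hPx).elim
    · exact h
    · exact (tri _ _ _ hye h hyb).elim
  have : d ∉ T z := by
    rw [hZe]; rintro (rfl | rfl | rfl)
    · exact hP _ _ hxd hPx hPe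
    · exact hQ _ _ had hQa hQf
    · exact hG.indep S hS _ hx _ hz hxd
  obtain ⟨t, ht, h⟩ := domYZ d hdY this
  rcases (hZe t).1 ht with rfl | rfl | rfl
  · exact tri _ _ _ had h hea.symm
  · exact tri _ _ _ hxd h hxf
  · exact tri _ _ _ had h haz

theorem MutDom.owns_pair (hG : MutDom H 3 G) {S S' : Finset V} {v : V}
    (h : Owns G S v) (h' : Owns G S' v) (hne : S ≠ S') :
    ∃ x y y', x ≠ v ∧ y ≠ y' ∧ H.Adj y y' ∧ (∀ w, w ∈ S ↔ w = v ∨ w = x ∨ w = y) ∧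
      (∀ w, w ∈ S' ↔ w = v ∨ w = x ∨ w = y') := by
  obtain ⟨x, hx, hx', hxv⟩ := h.2.2 S' h'.1 hne.symm h'.2.1
  obtain ⟨y, hy, hyv, hyx, hS⟩ := exists_third (hG.card S h.1) h.2.1 hx hxv.symm
  obtain ⟨y', hy', hyv', hyx', hS'⟩ := exists_third (hG.card S' h'.1) h'.2.1 hx' hxv.symm
  have hyy : y ≠ y' := by
    rintro rfl
    exact hne (Finset.ext fun w => (hS w).trans (hS' w).symm)
  refine ⟨x, y, y', hxv, hyy, ?_, hS, hS'⟩
  obtain ⟨t, ht, hadj⟩ := hG.dom S h.1 S' h'.1 y hy (by rw [hS']; simp [hyv, hyx, hyy])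
  rcases (hS' t).1 ht with rfl | rfl | rfl
  · exact (hG.indep S h.1 _ hy _ h.2.1 hadj).elim
  · exact (hG.indep S h.1 _ hy _ hx hadj).elim
  · exact hadj

/-- If two members own a common vertex, no third member contains that vertex. -/
theorem MutDom.owns_pair_mem (hG : MutDom H 3 G) (h3 : H.CliqueFree 3) {S S' T : Finset V} {v : V}
    (h : Owns G S v) (h' : Owns G S' v) (hne : S ≠ S') (hT : T ∈ G) (hv : v ∈ T) :
    T = S ∨ T = S' := by
  obtain ⟨x, y, y', hxv, hyy, hadj, hS, hS'⟩ := hG.owns_pair h h' hne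
  by_contra! hcon
  have hxT : x ∈ T := by
    obtain ⟨w, hw, hwT, hwv⟩ := h.2.2 T hT hcon.1 hv
    obtain ⟨w', hw', hwT', hwv'⟩ := h'.2.2 T hT hcon.2 hv
    rcases (hS w).1 hw with rfl | rfl | rfl
    · exact (hwv rfl).elim
    · exact hwT
    rcases (hS' w').1 hw' with rfl | rfl | rfl
    · exact (hwv' rfl).elim
    · exact hwT'
    · exact (hG.indep T hT _ hwT _ hwT' hadj).elim
  obtain ⟨u, hu, huv, hux, hTe⟩ := exists_third (hG.card T hT) hv hxT hxv.symm
  have key : ∀ {R : Finset V} {r : V}, R ∈ G → T ≠ R → (∀ w, w ∈ R ↔ w = v ∨ w = x ∨ w = r) →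
      H.Adj u r := by
    intro R r hR hTR hRe
    have hur : u ≠ r := by
      rintro rfl
      exact hTR (Finset.ext fun w => (hTe w).trans (hRe w).symm)
    obtain ⟨t, ht, hadj⟩ := hG.dom T hT R hR u hu (by rw [hRe]; simp [huv, hux, hur])
    rcases (hRe t).1 ht with rfl | rfl | rfl
    · exact (hG.indep T hT _ hu _ hv hadj).elim
    · exact (hG.indep T hT _ hu _ hxT hadj).elim
    · exact hadj
  exact no_triangle h3 (key h.1 hcon.1 hS) hadj (key h'.1 hcon.2 hS')

theorem MutDom.owns_or_owns (hG : MutDom H 3 G) (h3 : H.CliqueFree 3) (hK : 4096 < G.card)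
    {S S' : Finset V} {v x : V} (h : Owns G S v) (h' : Owns G S' v) (hne : S ≠ S')
    (hx : x ∈ S) (hx' : x ∈ S') (hxv : x ≠ v) : Owns G S x ∨ Owns G S' x := by
  by_contra! hcon
  obtain ⟨x₁, y, y', hxv₁, hyy, hadj, hS, hS'⟩ := hG.owns_pair h h' hne
  have hxx : x = x₁ := by
    rcases (hS x).1 hx with rfl | rfl | rfl
    · exact (hxv rfl).elim
    · rfl
    rcases (hS' x).1 hx' with rfl | rfl | rfl
    · exact (hxv rfl).elim
    · rfl
    · exact (hyy rfl).elim
  subst hxx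
  obtain ⟨T, hT, -, hxT, hTS⟩ := not_owns h.1 hx hcon.1
  obtain ⟨T', hT', -, hxT', hTS'⟩ := not_owns h'.1 hx' hcon.2
  have hWc : (S ∪ S' ∪ (T ∪ T')).card ≤ 12 := by
    have h1 := Finset.card_union_le (S ∪ S') (T ∪ T')
    have h2 := Finset.card_union_le S S'
    have h3 := Finset.card_union_le T T'
    rw [hG.card _ h.1, hG.card _ h'.1] at h2
    rw [hG.card _ hT, hG.card _ hT'] at h3
    omega
  obtain ⟨P, Q, hP, hQ, hPQ, hit⟩ := hG.exists_hitting h3 (S ∪ S' ∪ (T ∪ T'))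
    ((Nat.pow_le_pow_right (by norm_num) hWc).trans_lt (by norm_num; exact hK))
  have hitS := hit S h.1 (fun w hw => by simp [hw])
  have hitS' := hit S' h'.1 (fun w hw => by simp [hw])
  have hitT := hit T hT (fun w hw => by simp [hw])
  have hitT' := hit T' hT' (fun w hw => by simp [hw])
  clear hit hWc
  have main : ∀ P Q : V → Prop, (∀ u v, H.Adj u v → Q u → Q v → False) →
      (∀ u, P u → Q u → False) → (∃ q ∈ T, Q q) → (∃ q ∈ T', Q q) → P x → Q v → False := by
    intro P Q hQ hPQ hqT hqT' hPx hQv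
    obtain ⟨c, hc, hQc⟩ := hqT
    obtain ⟨c', hc', hQc'⟩ := hqT'
    have key : ∀ {R U : Finset V} {r c : V}, R ∈ G → U ∈ G → x ∈ U →
        (∀ w, w ∈ R ↔ w = v ∨ w = x ∨ w = r) → c ∈ U → Q c → c ∉ R → H.Adj c r := by
      intro R U r c hR hU hxU hRe hcU hQc hcR
      obtain ⟨t, ht, hadj⟩ := hG.dom U hU R hR c hcU hcR
      rcases (hRe t).1 ht with rfl | rfl | rfl
      · exact (hQ _ _ hadj hQc hQv).elim
      · exact (hG.indep U hU _ hcU _ hxU hadj).elim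
      · exact hadj
    have hcx : c ≠ x := by rintro rfl; exact hPQ _ hPx hQc
    have hcx' : c' ≠ x := by rintro rfl; exact hPQ _ hPx hQc'
    have hcy := key h.1 hT hxT hS hc hQc (fun hcS => hcx (hTS _ hcS hc))
    have hcy' := key h'.1 hT' hxT' hS' hc' hQc' (fun hcS => hcx' (hTS' _ hcS hc'))
    by_cases hcS' : c ∈ S'
    · rcases (hS' c).1 hcS' with rfl | rfl | rfl
      · exact hxv (hTS _ h.2.1 hc).symm
      · exact hcx rfl
      · exact hQ _ _ hcy' hQc' hQc
    · exact no_triangle h3 hcy hadj (key h'.1 hT hxT hS' hc hQc hcS')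
  have two : ∀ P : V → Prop, (∀ u v, H.Adj u v → P u → P v → False) → (∃ p ∈ S, P p) →
      (∃ p ∈ S', P p) → P v ∨ P x := by
    rintro P hP ⟨p, hp, hPp⟩ ⟨p', hp', hPp'⟩
    rcases (hS p).1 hp with rfl | rfl | rfl
    · exact Or.inl hPp
    · exact Or.inr hPp
    rcases (hS' p').1 hp' with rfl | rfl | rfl
    · exact Or.inl hPp'
    · exact Or.inr hPp'
    · exact (hP _ _ hadj hPp hPp').elim
  rcases two P hP hitS.1 hitS'.1 with hp | hp <;> rcases two Q hQ hitS.2 hitS'.2 with hq | hq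
  · exact hPQ _ hp hq
  · exact main Q P hP (fun u h1 h2 => hPQ u h2 h1) hitT.1 hitT'.1 hq hp
  · exact main P Q hQ hPQ hitT.2 hitT'.2 hp hq
  · exact hPQ _ hp hq

end Local

theorem sum_card_filter_adj_le {V : Type*} [Fintype V] {H : SimpleGraph V} [DecidableRel H.Adj]
    (U : Finset V) :
    ∑ v ∈ U, (U.filter (H.Adj v)).card ≤ 2 * H.edgeFinset.card := by
  rw [← H.sum_degrees_eq_twice_card_edges]
  refine (Finset.sum_le_sum fun v _ => ?_).trans
    (Finset.sum_le_sum_of_subset (Finset.subset_univ U))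
  rw [← H.card_neighborFinset_eq_degree]
  exact Finset.card_le_card fun w hw => by simpa using (Finset.mem_filter.1 hw).2

theorem MutDom.card_le_two {V : Type*} {H : SimpleGraph V} {G : Finset (Finset V)}
    (hG : MutDom H 1 G) (h3 : H.CliqueFree 3) : G.card ≤ 2 := by
  by_contra! h
  obtain ⟨A, B, C, hA, hB, hC, hAB, hAC, hBC⟩ := Finset.two_lt_card_iff.1 h
  have key : ∀ {S T : Finset V} {a b : V}, S ∈ G → T ∈ G → S = {a} → T = {b} → S ≠ T →
      H.Adj a b := by
    rintro S T a b hS hT rfl rfl hne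
    obtain ⟨t, ht, hadj⟩ := hG.dom _ hS _ hT a (by simp)
      (by rw [Finset.mem_singleton]; rintro rfl; exact hne rfl)
    rwa [Finset.mem_singleton.1 ht] at hadj
  obtain ⟨a, ha⟩ := Finset.card_eq_one.1 (hG.card A hA)
  obtain ⟨b, hb⟩ := Finset.card_eq_one.1 (hG.card B hB)
  obtain ⟨c, hc⟩ := Finset.card_eq_one.1 (hG.card C hC)
  exact no_triangle h3 (key hA hB ha hb hAB) (key hB hC hb hc hBC) (key hA hC ha hc hAC)

section Local

variable {V : Type*} [DecidableEq V] {H : SimpleGraph V} {G : Finset (Finset V)}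

theorem MutDom.card_le_card_biUnion [Countable V] (hG : MutDom H 3 G) (h3 : H.CliqueFree 3)
    (hK : 4096 < G.card) : G.card ≤ (G.biUnion id).card := by
  obtain ⟨f, hf⟩ := Countable.exists_injective_nat V
  obtain ⟨k, hk⟩ := Countable.exists_injective_nat (Finset V)
  let Claims (S : Finset V) (v : V) : Prop := Owns G S v ∧
    ∀ S', S' ≠ S → Owns G S' v → ∀ x ∈ S, x ∈ S' → x ≠ v → ¬ Owns G S x ∨
      (Owns G S' x ∧ ((k S < k S' ∧ f v < f x) ∨ (k S' < k S ∧ f x < f v)))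
  have hex : ∀ S ∈ G, ∃ v, Claims S v := by
    intro S hS
    obtain ⟨v, hv⟩ := hG.exists_owns h3 hK hS
    by_cases hc : Claims S v
    · exact ⟨v, hc⟩
    simp only [Claims, not_and, not_forall, not_or, not_not] at hc
    obtain ⟨S', hne, hv', x, hx, hx', hxv, hSx, hord⟩ := hc hv
    refine ⟨x, hSx, fun S'' hne'' hS''x w hw hw' hwx => Or.inr ?_⟩
    obtain rfl : S' = S'' :=
      (hG.owns_pair_mem h3 hSx hS''x hne''.symm hv'.1 hx').resolve_left hne
    have hwv : w = v := by
      obtain ⟨a, b, b', hav, hbb, -, hSe, hSe'⟩ := hG.owns_pair hv hv' hne.symm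
      have h1 := (hSe w).1 hw
      have h2 := (hSe' w).1 hw'
      have h3 := (hSe x).1 hx
      have h4 := (hSe' x).1 hx'
      grind
    subst hwv
    have h1 := hord hS''x
    have h2 : f w ≠ f x := fun h => hwx (hf h)
    have h3 : k S ≠ k S' := fun h => hne (hk h).symm
    exact ⟨hv', by omega⟩
  obtain ⟨S₀, hS₀⟩ := Finset.card_pos.1 ((Nat.zero_le _).trans_lt hK)
  obtain ⟨v₀, -⟩ := hex S₀ hS₀
  have : Nonempty V := ⟨v₀⟩
  choose! c hc using hex
  refine Finset.card_le_card_of_injOn c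
    (fun S hS => Finset.mem_coe.2 (Finset.mem_biUnion.2 ⟨S, hS, (hc S hS).1.2.1⟩)) ?_
  intro S hS S' hS' heq
  by_contra hne
  obtain ⟨h1, h2⟩ := hc S hS
  obtain ⟨h1', h2'⟩ := hc S' hS'
  rw [← heq] at h1' h2'
  obtain ⟨x, y, y', hxv, -, -, hSe, hSe'⟩ := hG.owns_pair h1 h1' hne
  have hx : x ∈ S := (hSe x).2 (by simp)
  have hx' : x ∈ S' := (hSe' x).2 (by simp)
  have h3 := hG.owns_or_owns h3 hK h1 h1' hne hx hx' hxv
  have h4 := h2 S' (Ne.symm hne) h1' x hx hx' hxv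
  have h5 := h2' S hne h1 x hx' hx hxv
  have h6 : Owns G S x ∧ Owns G S' x := by tauto
  simp only [h6.1, h6.2, not_true, false_or, true_and] at h4 h5
  omega

/-- The link of `u` in `G`. -/
def link (G : Finset (Finset V)) (u : V) : Finset (Finset V) :=
  (G.filter (u ∈ ·)).image (·.erase u)

theorem mem_link {u : V} {L : Finset V} : L ∈ link G u ↔ ∃ S ∈ G, u ∈ S ∧ S.erase u = L := by
  simp [link, and_assoc]

theorem card_link (G : Finset (Finset V)) (u : V) :
    (link G u).card = (G.filter (u ∈ ·)).card := by
  apply Finset.card_image_of_injOn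
  intro S hS T hT h
  simp only [Finset.coe_filter, Set.mem_ofPred_eq] at hS hT
  rw [← Finset.insert_erase hS.2, ← Finset.insert_erase hT.2]
  exact congrArg _ h

theorem MutDom.link {r : ℕ} (hG : MutDom H (r + 1) G) (u : V) : MutDom H r (link G u) := by
  constructor
  · intro L hL
    obtain ⟨S, hS, hu, rfl⟩ := mem_link.1 hL
    rw [Finset.card_erase_of_mem hu, hG.card S hS]; rfl
  · intro L hL x hx y hy
    obtain ⟨S, hS, hu, rfl⟩ := mem_link.1 hL
    exact hG.indep S hS x (Finset.mem_of_mem_erase hx) y (Finset.mem_of_mem_erase hy)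
  · intro L hL L' hL' v hv hv'
    obtain ⟨S, hS, hu, rfl⟩ := mem_link.1 hL
    obtain ⟨T, hT, huT, rfl⟩ := mem_link.1 hL'
    rw [Finset.mem_erase] at hv hv'
    obtain ⟨t, ht, hadj⟩ := hG.dom S hS T hT v hv.2 (fun h => hv' ⟨hv.1, h⟩)
    refine ⟨t, Finset.mem_erase.2 ⟨?_, ht⟩, hadj⟩
    rintro rfl
    exact hG.indep S hS _ hv.2 _ hu hadj

theorem MutDom.sum_card_filter {r : ℕ} (hG : MutDom H r G) :
    ∑ u ∈ G.biUnion id, (G.filter (u ∈ ·)).card = r * G.card := by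
  have h := Finset.sum_card_bipartiteAbove_eq_sum_card_bipartiteBelow
    (s := G.biUnion id) (t := G) (fun (u : V) (S : Finset V) => u ∈ S)
  simp only [Finset.bipartiteAbove, Finset.bipartiteBelow] at h
  rw [h, Finset.sum_congr rfl (g := fun _ => r), Finset.sum_const, smul_eq_mul, mul_comm]
  intro S hS
  rw [← hG.card S hS]
  congr 1
  ext w
  simp only [Finset.mem_filter, Finset.mem_biUnion, id]
  exact ⟨fun h => h.2, fun h => ⟨⟨S, hS, h⟩, h⟩⟩

/-- An intersecting family without a common vertex has a large double link. -/
theorem exists_card_le_link_link {r : ℕ} (hc : ∀ S ∈ G, S.card = r)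
    (hi : ∀ S ∈ G, ∀ T ∈ G, S ≠ T → (S ∩ T).Nonempty) (hr : 0 < r) (hne : G.Nonempty)
    (hw : ∀ w, ∃ T ∈ G, w ∉ T) : ∃ w t, G.card ≤ r * r * (link (link G w) t).card := by
  have hi' : ∀ S ∈ G, ∀ T ∈ G, (S ∩ T).Nonempty := fun S hS T hT => by
    by_cases h : S = T
    · subst h
      rw [Finset.inter_self, ← Finset.card_pos, hc S hS]; exact hr
    · exact hi S hS T hT h
  have avg : ∀ (A : Finset (Finset V)) (T : Finset V), T ∈ G →
      (∀ S ∈ A, ∃ t ∈ T, t ∈ S) → ∃ t, A.card ≤ r * (link A t).card := by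
    intro A T hT hA
    have hTne : T.Nonempty := by rw [← Finset.card_pos, hc T hT]; exact hr
    obtain ⟨t, -, ht⟩ := T.exists_max_image (fun t => (link A t).card) hTne
    refine ⟨t, ?_⟩
    rw [← hc T hT, ← smul_eq_mul]
    refine le_trans ?_ (Finset.sum_le_card_nsmul T (fun t => (link A t).card) _ ht)
    simp only [card_link]
    refine le_trans (Finset.card_le_card fun S hS => ?_) Finset.card_biUnion_le
    obtain ⟨t, ht, htS⟩ := hA S hS
    exact Finset.mem_biUnion.2 ⟨t, ht, Finset.mem_filter.2 ⟨hS, htS⟩⟩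
  obtain ⟨S₀, hS₀⟩ := hne
  obtain ⟨w, hw1⟩ := avg G S₀ hS₀ fun S hS => by
    obtain ⟨t, ht⟩ := hi' S₀ hS₀ S hS
    exact ⟨t, Finset.mem_of_mem_inter_left ht, Finset.mem_of_mem_inter_right ht⟩
  obtain ⟨T, hT, hwT⟩ := hw w
  obtain ⟨t, ht⟩ := avg (link G w) T hT fun L hL => by
    obtain ⟨S, hS, -, rfl⟩ := mem_link.1 hL
    obtain ⟨t, ht⟩ := hi' T hT S hS
    rw [Finset.mem_inter] at ht
    exact ⟨t, ht.1, Finset.mem_erase.2 ⟨by rintro rfl; exact hwT ht.1, ht.2⟩⟩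
  refine ⟨w, t, hw1.trans ?_⟩
  rw [mul_assoc]
  exact Nat.mul_le_mul_left _ ht

theorem MutDom.card_mul_card_le [DecidableRel H.Adj] {r : ℕ} (hG : MutDom H r G) :
    (G.biUnion id).card * G.card ≤ r * G.card + ∑ v ∈ G.biUnion id,
      ((G.biUnion id).filter (H.Adj v)).card * (G.filter (v ∈ ·)).card := by
  set U := G.biUnion id with hU
  have key : ∀ u ∈ U, G.card ≤ (G.filter (u ∈ ·)).card +
      ∑ v ∈ U.filter (H.Adj u), (G.filter (v ∈ ·)).card := by
    intro u hu
    obtain ⟨S, hS, huS⟩ := Finset.mem_biUnion.1 hu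
    rw [← Finset.card_filter_add_card_filter_not (u ∈ ·)]
    refine Nat.add_le_add_left (le_trans (Finset.card_le_card ?_) Finset.card_biUnion_le) _
    intro T hT
    rw [Finset.mem_filter] at hT
    obtain ⟨t, ht, hadj⟩ := hG.dom S hS T hT.1 u huS hT.2
    simp only [Finset.mem_biUnion, Finset.mem_filter]
    exact ⟨t, ⟨Finset.mem_biUnion.2 ⟨T, hT.1, ht⟩, hadj⟩, hT.1, ht⟩
  have h1 := Finset.sum_le_sum key
  rw [Finset.sum_const, smul_eq_mul, Finset.sum_add_distrib, hG.sum_card_filter] at h1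
  refine h1.trans (Nat.add_le_add_left (le_of_eq ?_) _)
  simp only [Finset.sum_filter]
  rw [Finset.sum_comm]
  refine Finset.sum_congr rfl fun v _ => ?_
  rw [← Finset.sum_filter, Finset.sum_const, smul_eq_mul]
  simp only [H.adj_comm]

variable [Fintype V] [DecidableRel H.Adj]

theorem MutDom.sq_card_le {r d : ℕ} (hG : MutDom H r G) (hU : G.card ≤ (G.biUnion id).card)
    (hd : ∀ v, (G.filter (v ∈ ·)).card ≤ d) :
    G.card ^ 2 ≤ r * G.card + 2 * H.edgeFinset.card * d := by
  have h1 := hG.card_mul_card_le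
  have h2 : ∑ v ∈ G.biUnion id,
      ((G.biUnion id).filter (H.Adj v)).card * (G.filter (v ∈ ·)).card ≤
      2 * H.edgeFinset.card * d := by
    refine (Finset.sum_le_sum fun v _ => Nat.mul_le_mul_left _ (hd v)).trans ?_
    rw [← Finset.sum_mul]
    exact Nat.mul_le_mul_right _ (sum_card_filter_adj_le _)
  have h3 := Nat.mul_le_mul_right G.card hU
  rw [sq]
  omega

theorem MutDom.sq_card_le_of_two (hG : MutDom H 2 G) (h3 : H.CliqueFree 3) :
    G.card ^ 2 ≤ 2 * G.card + 4 * H.edgeFinset.card := by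
  have hd : ∀ v, (G.filter (v ∈ ·)).card ≤ 2 := fun v => by
    rw [← card_link]; exact (hG.link v).card_le_two h3
  have hU : G.card ≤ (G.biUnion id).card := by
    have h := (hG.sum_card_filter.symm.trans_le (Finset.sum_le_sum fun v _ => hd v))
    rw [Finset.sum_const, smul_eq_mul] at h
    omega
  have := hG.sq_card_le hU hd
  omega

theorem MutDom.pow_card_le_of_three (hG : MutDom H 3 G) (h3 : H.CliqueFree 3)
    (hK : 4096 < G.card) : G.card ^ 4 ≤ 320 * H.edgeFinset.card ^ 3 := by
  set e := H.edgeFinset.card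
  have hd : ∀ v, (G.filter (v ∈ ·)).card ≤ Nat.sqrt (16 * e + 4) := fun v => by
    rw [← card_link, Nat.le_sqrt']
    have h := (hG.link v).sq_card_le_of_two h3
    change (_root_.link G v).card ^ 2 ≤ 2 * (_root_.link G v).card + 4 * e at h
    generalize (_root_.link G v).card = d at h
    rcases Nat.lt_or_ge d 4 with h4 | h4
    · interval_cases d <;> omega
    · nlinarith
  have h1 : G.card ^ 2 ≤ 3 * G.card + 2 * e * Nat.sqrt (16 * e + 4) :=
    hG.sq_card_le (hG.card_le_card_biUnion h3 hK) hd
  have h2 := Nat.sqrt_le' (16 * e + 4)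
  generalize Nat.sqrt (16 * e + 4) = D at h1 h2
  have h4 : G.card ^ 2 ≤ 4 * e * D := by nlinarith
  calc G.card ^ 4 = (G.card ^ 2) ^ 2 := by ring
    _ ≤ (4 * e * D) ^ 2 := Nat.pow_le_pow_left h4 2
    _ = 16 * e ^ 2 * D ^ 2 := by ring
    _ ≤ 16 * e ^ 2 * (16 * e + 4) := Nat.mul_le_mul_left _ h2
    _ ≤ 320 * e ^ 3 := by
      rcases Nat.eq_zero_or_pos e with h | h
      · simp [h]
      · nlinarith [Nat.mul_le_mul_left (e ^ 2) h]

theorem MutDom.le_of_four (hG : MutDom H 4 G) (h3 : H.CliqueFree 3) :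
    12 * (G.biUnion id).card * G.card ≤
      16448 * G.card + 18 * ((G.biUnion id).card + 4096) * H.edgeFinset.card := by
  set U := G.biUnion id with hU
  have hdg : ∀ u, (G.filter (u ∈ ·)).card + (U.filter (H.Adj u)).card ≤ U.card + 4096 := by
    intro u
    have h1 := U.card_filter_add_card_filter_not (H.Adj u)
    rw [← card_link]
    rcases Nat.lt_or_ge 4096 (_root_.link G u).card with h | h
    · have h2 := (hG.link u).card_le_card_biUnion h3 h
      have h4 : ((_root_.link G u).biUnion id).card ≤
          (U.filter (fun w => ¬ H.Adj u w)).card := by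
        refine Finset.card_le_card fun w hw => ?_
        obtain ⟨L, hL, hwL⟩ := Finset.mem_biUnion.1 hw
        obtain ⟨S, hS, hu, rfl⟩ := mem_link.1 hL
        have hwS : w ∈ S := Finset.mem_of_mem_erase hwL
        exact Finset.mem_filter.2 ⟨Finset.mem_biUnion.2 ⟨S, hS, hwS⟩, hG.indep S hS u hu w hwS⟩
      omega
    · omega
  have h1 : U.card * G.card ≤ 4 * G.card +
      ∑ v ∈ U, (U.filter (H.Adj v)).card * (G.filter (v ∈ ·)).card := hG.card_mul_card_le
  have h2 : ∑ v ∈ U, (U.filter (H.Adj v)).card ≤ 2 * H.edgeFinset.card :=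
    sum_card_filter_adj_le U
  have h4 : ∑ v ∈ U, (G.filter (v ∈ ·)).card = 4 * G.card := hG.sum_card_filter
  have h5 : 16 * ∑ v ∈ U, (U.filter (H.Adj v)).card * (G.filter (v ∈ ·)).card ≤
      9 * (U.card + 4096) * ∑ v ∈ U, (U.filter (H.Adj v)).card +
        (U.card + 4096) * ∑ v ∈ U, (G.filter (v ∈ ·)).card := by
    rw [Finset.mul_sum, Finset.mul_sum, Finset.mul_sum, ← Finset.sum_add_distrib]
    refine Finset.sum_le_sum fun v _ => ?_
    have := hdg v
    generalize (G.filter (v ∈ ·)).card = d at *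
    generalize (U.filter (H.Adj v)).card = g at *
    generalize U.card + 4096 = M at *
    zify at *
    nlinarith [sq_nonneg (3 * (g : ℤ) - d)]
  rw [h4] at h5
  nlinarith [Nat.mul_le_mul_left (9 * (U.card + 4096)) h2]

end Local

theorem Is3TSystem.mutDom {V : Type*} [DecidableEq V] {H : SimpleGraph V}
    {F : Finset (Finset V)} {t : ℕ} (h : Is3TSystem t H F) : MutDom H t F :=
  ⟨fun S hS => (h.2.1 S hS).1, fun S hS => (h.2.1 S hS).2.1,
    fun _ _ T hT v _ hv => (h.2.1 T hT).2.2 v hv⟩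

theorem card_lower_bound_of_common {V : Type*} [Fintype V] [DecidableEq V] {H : SimpleGraph V}
    [DecidableRel H.Adj] {F : Finset (Finset V)} (hF : MutDom H 5 F) (h3 : H.CliqueFree 3)
    {w : V} (hw : ∀ S ∈ F, w ∈ S) {ε : ℝ} (hε : 0 < ε) (hs : 2 ^ ⌈4000 / ε⌉₊ < F.card) :
    ((2 : ℝ) / 3 - ε) * F.card ≤ H.edgeFinset.card := by
  have hG : MutDom H 4 (link F w) := hF.link w
  have hK : (link F w).card = F.card := by
    rw [card_link, Finset.filter_true_of_mem hw]
  have h := hG.le_of_four h3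
  rw [hK] at h
  have hn : ⌈4000 / ε⌉₊ < ((link F w).biUnion id).card := by
    have h1 : (link F w).card ≤ 2 ^ ((link F w).biUnion id).card := by
      rw [← Finset.card_powerset]
      exact Finset.card_le_card fun S hS =>
        Finset.mem_powerset.2 (Finset.subset_biUnion_of_mem id hS)
    rw [hK] at h1
    exact (Nat.pow_lt_pow_iff_right (by norm_num)).1 (hs.trans_le h1)
  have hn' := Nat.lt_of_ceil_lt hn
  generalize ((link F w).biUnion id).card = n at *
  rw [div_lt_iff₀ hε] at hn'
  have hR : (12 : ℝ) * n * F.card ≤ 16448 * F.card + 18 * (n + 4096) * H.edgeFinset.card := by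
    exact_mod_cast h
  have hF0 : (0 : ℝ) ≤ F.card := Nat.cast_nonneg _
  have hn0 : (0 : ℝ) ≤ n := Nat.cast_nonneg _
  by_contra! hlt
  have h1 := mul_lt_mul_of_pos_left hlt (show (0 : ℝ) < 18 * (n + 4096) by positivity)
  nlinarith [mul_le_mul_of_nonneg_right hn'.le hF0, mul_nonneg hε.le hF0]

theorem Is3TSystem.lower_bound {V : Type*} [Fintype V] [DecidableEq V] {H : SimpleGraph V}
    {F : Finset (Finset V)} (hF : Is3TSystem 5 H F) {ε : ℝ} (hε : 0 < ε)
    (hs : 2 ^ ⌈4000 / ε⌉₊ < F.card) (hs' : 125000000 < F.card) :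
    ((2 : ℝ) / 3 - ε) * F.card ≤ H.edgeSet.ncard := by
  classical
  have he : H.edgeSet.ncard = H.edgeFinset.card := by
    rw [← coe_edgeFinset, Set.ncard_coe_finset]
  rw [he]
  have hM := hF.mutDom
  by_cases hw : ∃ w, ∀ S ∈ F, w ∈ S
  · obtain ⟨w, hw⟩ := hw
    exact card_lower_bound_of_common hM hF.1 hw hε hs
  push Not at hw
  obtain ⟨w, t, hwt⟩ := exists_card_le_link_link hM.card hF.2.2 (by norm_num)
    (Finset.card_pos.1 (by omega)) hw
  have hL := ((hM.link w).link t).pow_card_le_of_three hF.1 (by omega)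
  have h1 : F.card ^ 4 ≤ 125000000 * H.edgeFinset.card ^ 3 := by
    have := Nat.pow_le_pow_left hwt 4
    rw [mul_pow] at this
    omega
  have h2 : F.card ≤ H.edgeFinset.card := by
    by_contra! hlt
    have h5 := Nat.pow_le_pow_left hlt.le 3
    have h6 : F.card ^ 4 ≤ 125000000 * F.card ^ 3 := h1.trans (Nat.mul_le_mul_left _ h5)
    rw [pow_succ', Nat.mul_le_mul_right_iff (by positivity)] at h6
    omega
  have h3 : (F.card : ℝ) ≤ H.edgeFinset.card := by exact_mod_cast h2
  nlinarith [mul_nonneg hε.le (Nat.cast_nonneg (α := ℝ) F.card),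
    Nat.cast_nonneg (α := ℝ) F.card]

theorem exists_isMax3TSystem {V : Type*} [Finite V] [DecidableEq V] {H : SimpleGraph V}
    {F : Finset (Finset V)} {t : ℕ} (h : Is3TSystem t H F) :
    ∃ H', H ≤ H' ∧ IsMax3TSystem t H' F := by
  let A : Set (SimpleGraph V) :=
    {H' | H ≤ H' ∧ H'.CliqueFree 3 ∧ ∀ S ∈ F, ∀ u ∈ S, ∀ v ∈ S, ¬ H'.Adj u v}
  have hA : H ∈ A := ⟨le_rfl, h.1, fun S hS => (h.2.1 S hS).2.1⟩
  obtain ⟨H', -, hmax⟩ := A.toFinite.exists_le_maximal hA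
  obtain ⟨hle, hfree, hind⟩ := hmax.prop
  refine ⟨H', hle, ⟨hfree, fun S hS => ⟨(h.2.1 S hS).1, hind S hS, fun v hv => ?_⟩, h.2.2⟩, ?_⟩
  · obtain ⟨u, hu, hadj⟩ := (h.2.1 S hS).2.2 v hv
    exact ⟨u, hu, hle hadj⟩
  · intro u v huv hadj
    by_contra! hcon
    have hmem : H' ⊔ fromEdgeSet {s(u, v)} ∈ A := by
      refine ⟨hle.trans le_sup_left, hcon.1, fun S hS a ha b hb hab => ?_⟩
      rcases hab with hab | hab
      · exact hind S hS a ha b hb hab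
      · simp only [fromEdgeSet_adj, Set.mem_singleton_iff, Sym2.eq_iff] at hab
        rcases hab.1 with ⟨rfl, rfl⟩ | ⟨rfl, rfl⟩
        · exact hcon.2 S hS ha hb
        · exact hcon.2 S hS hb ha
    have hle' := hmax.le_of_ge hmem le_sup_left
    exact hadj (hle' (Or.inr (by simp [huv])))

theorem IsMax3TSystem.transfer {V W : Type*} [DecidableEq V] [DecidableEq W]
    {H : SimpleGraph V} {F : Finset (Finset V)} {t : ℕ} (h : IsMax3TSystem t H F) (σ : V ≃ W) :
    IsMax3TSystem t (H.comap σ.symm) (F.image fun S => S.map σ.toEmbedding) := by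
  have hmem : ∀ (S : Finset V) (w : W), w ∈ S.map σ.toEmbedding ↔ σ.symm w ∈ S := fun S w => by
    simp [Finset.mem_map_equiv]
  refine ⟨⟨h.1.1.comap (SimpleGraph.Embedding.comap σ.symm.toEmbedding H).isContained, ?_, ?_⟩, ?_⟩
  · intro S' hS'
    obtain ⟨S, hS, rfl⟩ := Finset.mem_image.1 hS'
    obtain ⟨h1, h2, h3⟩ := h.1.2.1 S hS
    refine ⟨by rw [Finset.card_map, h1], fun u hu v hv => ?_, fun v hv => ?_⟩
    · exact h2 _ ((hmem S u).1 hu) _ ((hmem S v).1 hv)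
    · obtain ⟨u, hu, hadj⟩ := h3 (σ.symm v) (fun hv' => hv ((hmem S v).2 hv'))
      exact ⟨σ u, (hmem S _).2 (by simpa using hu), by simpa using hadj⟩
  · intro S' hS' T' hT' hne
    obtain ⟨S, hS, rfl⟩ := Finset.mem_image.1 hS'
    obtain ⟨T, hT, rfl⟩ := Finset.mem_image.1 hT'
    obtain ⟨x, hx⟩ := h.1.2.2 S hS T hT (by rintro rfl; exact hne rfl)
    rw [Finset.mem_inter] at hx
    exact ⟨σ x, by rw [Finset.mem_inter, hmem, hmem]; simpa using hx⟩
  · intro u v huv hadj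
    rcases h.2 (σ.symm u) (σ.symm v) (by simpa using huv) hadj with h1 | ⟨S, hS, hu, hv⟩
    · refine Or.inl fun hfree => h1 ?_
      let f : H ⊔ fromEdgeSet {s(σ.symm u, σ.symm v)} ↪g
          H.comap σ.symm ⊔ fromEdgeSet {s(u, v)} :=
        ⟨σ.toEmbedding, fun {a b} => by simp [Equiv.eq_symm_apply]⟩
      exact hfree.comap f.isContained
    · exact Or.inr ⟨_, Finset.mem_image_of_mem _ hS, (hmem S u).2 hu, (hmem S v).2 hv⟩

theorem ncard_edgeSet_comap_equiv {V W : Type*} (H : SimpleGraph V) (σ : V ≃ W) :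
    (H.comap σ.symm).edgeSet.ncard = H.edgeSet.ncard :=
  Nat.card_congr (SimpleGraph.Iso.comap σ.symm H).mapEdgeSet

section Construction

variable {N : ℕ}

/-- Two disjoint copies of the bipartite complement of a perfect matching on `N + N` vertices,
together with one isolated vertex. -/
def crownGraph (N : ℕ) : SimpleGraph (Option (Bool × Bool × Fin N)) where
  Adj u v := ∃ c p i j, i ≠ j ∧ u = some (c, p, i) ∧ v = some (c, !p, j)
  symm := ⟨by
    rintro _ _ ⟨c, p, i, j, hij, rfl, rfl⟩
    exact ⟨c, !p, j, i, hij.symm, rfl, by simp⟩⟩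
  loopless := ⟨by
    rintro _ ⟨c, p, i, j, hij, rfl, h⟩
    simp at h⟩

/-- The isolated vertex of `crownGraph N` with the `i`-th pair of the first copy and the `j`-th
pair of the second. -/
def crownSet (x : Fin N × Fin N) : Finset (Option (Bool × Bool × Fin N)) :=
  {none, some (false, false, x.1), some (false, true, x.1), some (true, false, x.2),
    some (true, true, x.2)}

theorem mem_crownSet {x : Fin N × Fin N} {c p : Bool} {i : Fin N} :
    some (c, p, i) ∈ crownSet x ↔ i = bif c then x.2 else x.1 := by
  cases c <;> cases p <;> simp [crownSet]

theorem crownSet_injective : Function.Injective (crownSet (N := N)) := by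
  intro x y h
  have h1 : some (false, false, x.1) ∈ crownSet y := by rw [← h, mem_crownSet]; rfl
  have h2 : some (true, false, x.2) ∈ crownSet y := by rw [← h, mem_crownSet]; rfl
  rw [mem_crownSet] at h1 h2
  exact Prod.ext h1 h2

theorem is3TSystem_crown (I : Finset (Fin N × Fin N)) :
    Is3TSystem 5 (crownGraph N) (I.image crownSet) := by
  refine ⟨?_, ?_, ?_⟩
  · intro s hs
    obtain ⟨a, b, c, hab, hac, hbc, rfl⟩ := is3Clique_iff.1 hs
    obtain ⟨_, p, _, _, _, rfl, rfl⟩ := hab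
    obtain ⟨_, q, _, _, _, h1, rfl⟩ := hac
    obtain ⟨_, r, _, _, _, h2, h3⟩ := hbc
    simp only [Option.some.injEq, Prod.mk.injEq] at h1 h2 h3
    revert h1 h2 h3
    cases p <;> cases q <;> cases r <;> simp
  · intro S hS
    obtain ⟨x, -, rfl⟩ := Finset.mem_image.1 hS
    refine ⟨by simp [crownSet], ?_, ?_⟩
    · rintro _ hu _ hv ⟨c, p, i, j, hij, rfl, rfl⟩
      rw [mem_crownSet] at hu hv
      exact hij (hu.trans hv.symm)
    · rintro (_ | ⟨c, p, i⟩) hv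
      · simp [crownSet] at hv
      · rw [mem_crownSet] at hv
        exact ⟨some (c, !p, bif c then x.2 else x.1), mem_crownSet.2 rfl,
          c, p, i, _, hv, rfl, rfl⟩
  · intro S hS T hT _
    obtain ⟨x, -, rfl⟩ := Finset.mem_image.1 hS
    obtain ⟨y, -, rfl⟩ := Finset.mem_image.1 hT
    exact ⟨none, by simp [crownSet]⟩

theorem ncard_edgeSet_le_of_crown (hN : 3 ≤ N) {I : Finset (Fin N × Fin N)}
    {H : SimpleGraph (Option (Bool × Bool × Fin N))} (hle : crownGraph N ≤ H)
    (hH : Is3TSystem 5 H (I.image crownSet)) :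
    H.edgeSet.ncard ≤ 2 * N ^ 2 + 4 * (N ^ 2 - I.card) + 4 * N := by
  classical
  let A : Finset (Sym2 (Option (Bool × Bool × Fin N))) :=
    (Finset.univ : Finset (Bool × Fin N × Fin N)).image
      fun x => s(some (x.1, false, x.2.1), some (x.1, true, x.2.2))
  let B : Finset (Sym2 (Option (Bool × Bool × Fin N))) :=
    ((Finset.univ : Finset (Bool × Bool)) ×ˢ Iᶜ).image
      fun x => s(some (false, x.1.1, x.2.1), some (true, x.1.2, x.2.2))
  let C : Finset (Sym2 (Option (Bool × Bool × Fin N))) :=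
    (Finset.univ : Finset (Bool × Bool × Fin N)).image fun x => s(none, some x)
  have hA : A.card ≤ 2 * N ^ 2 := by
    refine Finset.card_image_le.trans (le_of_eq ?_)
    simp [sq]
  have hB : B.card ≤ 4 * (N ^ 2 - I.card) := by
    refine Finset.card_image_le.trans (le_of_eq ?_)
    simp [Finset.card_compl, sq]
  have hC : C.card ≤ 4 * N := by
    refine Finset.card_image_le.trans (le_of_eq ?_)
    simp; ring
  have hsame : ∀ c p p' i j, H.Adj (some (c, p, i)) (some (c, p', j)) → p' = !p := by
    intro c p p' i j hadj
    by_contra hp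
    obtain rfl : p' = p := by cases p <;> cases p' <;> simp_all
    have : ∃ k : Fin N, k ≠ i ∧ k ≠ j := by
      have : ¬ (Finset.univ : Finset (Fin N)) ⊆ {i, j} := fun h => by
        have := (Finset.card_le_card h).trans Finset.card_le_two
        rw [Finset.card_univ, Fintype.card_fin] at this
        omega
      obtain ⟨k, -, hk⟩ := Finset.not_subset.1 this
      exact ⟨k, by simpa using hk⟩
    obtain ⟨k, hki, hkj⟩ := this
    exact no_triangle hH.1 (hle ⟨c, p', i, k, hki.symm, rfl, rfl⟩)
      (hle ⟨c, p', j, k, hkj.symm, rfl, rfl⟩ : H.Adj _ _).symm hadj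
  have hcross : ∀ p p' i j, H.Adj (some (false, p, i)) (some (true, p', j)) → (i, j) ∉ I := by
    intro p p' i j hadj hI
    exact (hH.2.1 _ (Finset.mem_image_of_mem _ hI)).2.1 _ (mem_crownSet.2 rfl) _
      (mem_crownSet.2 rfl) hadj
  have hsub : H.edgeSet ⊆ ((A ∪ B ∪ C : Finset _) : Set _) := by
    intro x
    induction x with | _ u v
    intro hadj
    rw [mem_edgeSet] at hadj
    simp only [Finset.coe_union, Set.mem_union, Finset.mem_coe]
    rcases u with _ | ⟨c, p, i⟩ <;> rcases v with _ | ⟨c', p', j⟩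
    · exact (H.loopless.irrefl _ hadj).elim
    · exact Or.inr (Finset.mem_image.2 ⟨_, Finset.mem_univ _, rfl⟩)
    · exact Or.inr (Finset.mem_image.2 ⟨_, Finset.mem_univ _, Sym2.eq_swap⟩)
    · left
      cases c <;> cases c'
      · obtain rfl := hsame _ _ _ _ _ hadj
        left
        cases p
        · exact Finset.mem_image.2 ⟨(false, i, j), Finset.mem_univ _, rfl⟩
        · exact Finset.mem_image.2 ⟨(false, j, i), Finset.mem_univ _, Sym2.eq_swap⟩
      · right
        exact Finset.mem_image.2 ⟨((p, p'), (i, j)), by simpa using hcross _ _ _ _ hadj, rfl⟩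
      · right
        exact Finset.mem_image.2 ⟨((p', p), (j, i)), by simpa using hcross _ _ _ _ hadj.symm,
          Sym2.eq_swap⟩
      · obtain rfl := hsame _ _ _ _ _ hadj
        left
        cases p
        · exact Finset.mem_image.2 ⟨(true, i, j), Finset.mem_univ _, rfl⟩
        · exact Finset.mem_image.2 ⟨(true, j, i), Finset.mem_univ _, Sym2.eq_swap⟩
  refine (Set.ncard_le_ncard hsub (Finset.finite_toSet _)).trans ?_
  rw [Set.ncard_coe_finset]
  have h1 := Finset.card_union_le (A ∪ B) C
  have h2 := Finset.card_union_le A B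
  omega

theorem exists_isMax3TSystem_card (hN : 3 ≤ N) {s : ℕ} (hs : s ≤ N ^ 2) :
    ∃ (m : ℕ) (H : SimpleGraph (Fin m)) (F : Finset (Finset (Fin m))),
      IsMax3TSystem 5 H F ∧ F.card = s ∧
      H.edgeSet.ncard ≤ 2 * N ^ 2 + 4 * (N ^ 2 - s) + 4 * N := by
  obtain ⟨I, -, rfl⟩ := Finset.exists_subset_card_eq (s := (Finset.univ : Finset (Fin N × Fin N)))
    (n := s) (by simpa [sq] using hs)
  obtain ⟨H, hle, hH⟩ := exists_isMax3TSystem (is3TSystem_crown I)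
  let σ := Fintype.equivFin (Option (Bool × Bool × Fin N))
  refine ⟨_, _, _, hH.transfer σ, ?_, ?_⟩
  · rw [Finset.card_image_of_injective _ (Finset.map_injective _),
      Finset.card_image_of_injective _ crownSet_injective]
  · rw [ncard_edgeSet_comap_equiv]
    exact ncard_edgeSet_le_of_crown hN hle hH.1

end Construction

theorem sqrt_bound {ε : ℝ} (hε : 0 < ε) {s : ℕ} (hs : (36 / ε) ^ 2 ≤ s) (hs1 : 1 ≤ s) :
    ((2 * (s.sqrt + 1) ^ 2 + 4 * ((s.sqrt + 1) ^ 2 - s) + 4 * (s.sqrt + 1) : ℕ) : ℝ) ≤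
      (2 + ε) * s := by
  have h1 : s ≤ (s.sqrt + 1) ^ 2 := (Nat.lt_succ_sqrt' s).le
  have h2 : s.sqrt ^ 2 ≤ s := Nat.sqrt_le' s
  have h3 : 1 ≤ s.sqrt := Nat.le_sqrt'.2 (by simpa using hs1)
  have h4 : 2 * (s.sqrt + 1) ^ 2 + 4 * ((s.sqrt + 1) ^ 2 - s) + 4 * (s.sqrt + 1) ≤
      2 * s + 26 * s.sqrt := by
    zify [h1]
    zify at h2 h3
    nlinarith
  refine (Nat.cast_le.2 h4).trans ?_
  push_cast
  have h5 : (s.sqrt : ℝ) ≤ √s := Real.nat_sqrt_le_real_sqrt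
  have h6 : 36 / ε ≤ √s := Real.le_sqrt_of_sq_le hs
  rw [div_le_iff₀ hε] at h6
  have h7 : √(s : ℝ) * √s = s := Real.mul_self_sqrt (Nat.cast_nonneg s)
  nlinarith [Real.sqrt_nonneg (s : ℝ)]

/-- `(2/3)s + o(s) ≤ e_{3,5}(s)` and `e'_{3,5}(s) ≤ 2s + o(s)`. -/
theorem stmt17 (ε : ℝ) (hε : 0 < ε) :
    ∃ S₀ : ℕ, ∀ s : ℕ, S₀ ≤ s →
      (∀ (V : Type) [Fintype V] [DecidableEq V] (H : SimpleGraph V) (F : Finset (Finset V)),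
        Is3TSystem 5 H F → F.card = s →
        ((2 : ℝ) / 3 - ε) * s ≤ (H.edgeSet.ncard : ℝ)) ∧
      (∃ (m : ℕ) (H : SimpleGraph (Fin m)) (F : Finset (Finset (Fin m))),
        IsMax3TSystem 5 H F ∧ F.card = s ∧
        (H.edgeSet.ncard : ℝ) ≤ ((2 : ℝ) + ε) * s) := by
  refine ⟨max (max (2 ^ ⌈4000 / ε⌉₊ + 1) 125000001) ⌈(36 / ε) ^ 2⌉₊, fun s hs => ?_⟩
  simp only [max_le_iff] at hs
  obtain ⟨⟨hs1, hs2⟩, hs3⟩ := hs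
  constructor
  · rintro V _ _ H F hF rfl
    exact hF.lower_bound hε hs1 hs2
  · have h2 : 2 ≤ s.sqrt := Nat.le_sqrt'.2 (by omega)
    obtain ⟨m, H, F, hF, hFs, he⟩ := exists_isMax3TSystem_card (N := s.sqrt + 1) (by omega)
      (Nat.lt_succ_sqrt' s).le
    exact ⟨m, H, F, hF, hFs, (Nat.cast_le.2 he).trans
      (sqrt_bound hε ((Nat.le_ceil _).trans (Nat.cast_le.2 hs3)) (by omega))⟩
end

section
/- For every integer t ≥ 3 and every (3,t)-system (H,F), there exists a (3,t+1)-system (H',F') with |F'| = |F| and e(H') ≤ e(H). In particular, the minimum number of edges of the graph of a (3,t+1)-system whose family has s sets is at most the minimum number of edges of the graph of a (3,t)-system whose family has s sets. -/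
open SimpleGraph

/-- Enlarging each set of a family of maximal independent `t`-sets of a triangle-free graph by
a common new isolated vertex `z` gives a `(3,t+1)`-system with as many sets and edges. -/
theorem is3TSystem_insert_isolated {V W : Type*} [DecidableEq V] [DecidableEq W]
    {t : ℕ} {H : SimpleGraph V} {F : Finset (Finset V)}
    (hH : H.CliqueFree 3)
    (hF : ∀ S ∈ F, S.card = t ∧
      (∀ u ∈ S, ∀ v ∈ S, ¬ H.Adj u v) ∧
      (∀ v : V, v ∉ S → ∃ u ∈ S, H.Adj v u))
    (f : V ↪ W) (z : W) (hz : ∀ v, f v ≠ z) (hcover : ∀ w, w = z ∨ ∃ v, f v = w) :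
    Is3TSystem (t + 1) (H.map f) (F.image fun S => insert z (S.map f)) ∧
      (F.image fun S => insert z (S.map f)).card = F.card ∧
      (H.map f).edgeSet.ncard = H.edgeSet.ncard := by
  have hzS : ∀ S : Finset V, z ∉ S.map f := by
    intro S h
    obtain ⟨v, -, hv⟩ := Finset.mem_map.1 h
    exact hz v hv
  refine ⟨⟨?_, ?_, ?_⟩, ?_, ?_⟩
  · intro s hs
    rw [is3Clique_iff] at hs
    obtain ⟨a, b, c, ⟨-, a', b', hab, rfl, rfl⟩,
      ⟨-, a₂, c', hac, h₂, rfl⟩, ⟨-, b₂, c₂, hbc, h₃, h₄⟩, -⟩ := hs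
    obtain rfl := f.injective h₂
    obtain rfl := f.injective h₃
    obtain rfl := f.injective h₄
    exact hH {a₂, b₂, c₂} (is3Clique_triple_iff.2 ⟨hab, hac, hbc⟩)
  · intro S' hS'
    obtain ⟨S, hS, rfl⟩ := Finset.mem_image.1 hS'
    obtain ⟨hcard, hind, hmax⟩ := hF S hS
    refine ⟨?_, ?_, ?_⟩
    · rw [Finset.card_insert_of_notMem (hzS S), Finset.card_map, hcard]
    · rintro _ hu _ hv ⟨-, a, b, hab, rfl, rfl⟩
      simp only [Finset.mem_insert, hz, false_or, Finset.mem_map' f] at hu hv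
      exact hind a hu b hv hab
    · intro w hw
      obtain rfl | ⟨v, rfl⟩ := hcover w
      · exact absurd (Finset.mem_insert_self _ _) hw
      · simp only [Finset.mem_insert, hz, false_or, Finset.mem_map' f] at hw
        obtain ⟨u, hu, huv⟩ := hmax v hw
        exact ⟨f u, Finset.mem_insert_of_mem ((Finset.mem_map' f).2 hu),
          (map_adj_apply (f := f)).2 huv⟩
  · intro S' hS' T' hT' _
    obtain ⟨S, -, rfl⟩ := Finset.mem_image.1 hS'
    obtain ⟨T, -, rfl⟩ := Finset.mem_image.1 hT'
    exact ⟨z, Finset.mem_inter.2 ⟨Finset.mem_insert_self _ _, Finset.mem_insert_self _ _⟩⟩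
  · refine Finset.card_image_of_injective _ fun S T h => Finset.map_injective f ?_
    have h' := congrArg (fun A : Finset W => A.erase z) h
    simpa only [Finset.erase_insert (hzS _)] using h'
  · rw [edgeSet_map]
    exact Set.ncard_image_of_injective _ f.sym2Map.injective

/-- A family of maximal independent `t`-sets of a triangle-free graph, not necessarily
intersecting, has as many sets as some `(3,t+1)`-system with the same number of edges. -/
theorem exists_fin_is3TSystem_succ {V : Type*} [Fintype V] [DecidableEq V]
    {t : ℕ} {H : SimpleGraph V} {F : Finset (Finset V)}
    (hH : H.CliqueFree 3)
    (hF : ∀ S ∈ F, S.card = t ∧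
      (∀ u ∈ S, ∀ v ∈ S, ¬ H.Adj u v) ∧
      (∀ v : V, v ∉ S → ∃ u ∈ S, H.Adj v u)) :
    ∃ (k : ℕ) (H' : SimpleGraph (Fin k)) (F' : Finset (Finset (Fin k))),
      Is3TSystem (t + 1) H' F' ∧ F'.card = F.card ∧
      H'.edgeSet.ncard = H.edgeSet.ncard := by
  let e := Fintype.equivFin V
  refine ⟨_, _, _, is3TSystem_insert_isolated hH hF
    (e.toEmbedding.trans Fin.castSuccEmb) (Fin.last _)
    (fun v => Fin.castSucc_ne_last (e v)) fun w => ?_⟩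
  induction w using Fin.lastCases with
  | last => exact Or.inl rfl
  | cast i => exact Or.inr ⟨e.symm i, congrArg Fin.castSucc (e.apply_symm_apply i)⟩

/-- The complete bipartite graph `K_{s,s}` with a perfect matching removed. -/
def bipartiteMinusMatching (s : ℕ) : SimpleGraph (Fin s × Bool) where
  Adj p q := p.1 ≠ q.1 ∧ p.2 ≠ q.2
  symm := ⟨fun _ _ h => ⟨h.1.symm, h.2.symm⟩⟩
  loopless := ⟨fun _ h => h.1 rfl⟩

theorem bipartiteMinusMatching_cliqueFree (s : ℕ) :
    (bipartiteMinusMatching s).CliqueFree 3 := by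
  intro S hS
  rw [is3Clique_iff] at hS
  obtain ⟨⟨_, a⟩, ⟨_, b⟩, ⟨_, c⟩, ⟨-, hab⟩, ⟨-, hac⟩, ⟨-, hbc⟩, -⟩ := hS
  cases a <;> cases b <;> cases c <;> simp_all

/-- For every `t ≥ 3` there are `(3,t)`-systems with any prescribed number of sets. -/
theorem exists_is3TSystem_card {t : ℕ} (ht : 3 ≤ t) (s : ℕ) :
    ∃ (m : ℕ) (H : SimpleGraph (Fin m)) (F : Finset (Finset (Fin m))),
      Is3TSystem t H F ∧ F.card = s := by
  induction t, ht using Nat.le_induction with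
  | base =>
    let g : Fin s → Finset (Fin s × Bool) := fun i => {(i, false), (i, true)}
    have hg : Function.Injective g := by
      intro i j h
      have : (i, false) ∈ g j := h ▸ by simp [g]
      simpa [g] using this
    obtain ⟨k, H', F', h, hc, -⟩ := exists_fin_is3TSystem_succ (t := 2)
      (F := Finset.univ.image g) (bipartiteMinusMatching_cliqueFree s) (by
        intro S hS
        obtain ⟨i, -, rfl⟩ := Finset.mem_image.1 hS
        refine ⟨by simp [g], ?_, ?_⟩
        · rintro ⟨a, x⟩ hu ⟨b, y⟩ hv ⟨hab, -⟩
          simp only [g, Finset.mem_insert, Finset.mem_singleton, Prod.mk.injEq] at hu hv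
          grind
        · rintro ⟨a, x⟩ hv
          have hai : a ≠ i := by
            rintro rfl
            cases x <;> simp [g] at hv
          exact ⟨(i, !x), by cases x <;> simp [g], hai, by simp⟩)
    exact ⟨k, H', F', h, by rw [hc, Finset.card_image_of_injective _ hg]; simp⟩
  | succ t _ ih =>
    obtain ⟨m, H, F, hHF, hc⟩ := ih
    obtain ⟨k, H', F', h, hc', -⟩ := exists_fin_is3TSystem_succ hHF.1 hHF.2.1
    exact ⟨k, H', F', h, hc'.trans hc⟩

/-- For `t ≥ 3`, every `(3,t)`-system yields a `(3,t+1)`-system with the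
same number of sets and no more edges; in particular `e_{3,t+1}(s) ≤ e_{3,t}(s)`. -/
theorem stmt18 (t : ℕ) (ht : 3 ≤ t) :
    (∀ (V : Type) [Fintype V] [DecidableEq V] (H : SimpleGraph V) (F : Finset (Finset V)),
      Is3TSystem t H F →
      ∃ (k : ℕ) (H' : SimpleGraph (Fin k)) (F' : Finset (Finset (Fin k))),
        Is3TSystem (t + 1) H' F' ∧ F'.card = F.card ∧
        H'.edgeSet.ncard ≤ H.edgeSet.ncard) ∧
    (∀ s : ℕ, e3min (t + 1) s ≤ e3min t s) := by
  refine ⟨fun V _ _ H F hHF => ?_, fun s => ?_⟩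
  · obtain ⟨k, H', F', h, hc, he⟩ := exists_fin_is3TSystem_succ hHF.1 hHF.2.1
    exact ⟨k, H', F', h, hc, he.le⟩
  · obtain ⟨m, H, F, hHF, hc⟩ := exists_is3TSystem_card ht s
    obtain ⟨m, H, F, hHF, hc, he⟩ := Nat.sInf_mem (s := {e : ℕ | ∃ (m : ℕ)
      (H : SimpleGraph (Fin m)) (F : Finset (Finset (Fin m))),
      Is3TSystem t H F ∧ F.card = s ∧ H.edgeSet.ncard = e}) ⟨_, m, H, F, hHF, hc, rfl⟩
    obtain ⟨k, H', F', h, hc', he'⟩ := exists_fin_is3TSystem_succ hHF.1 hHF.2.1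
    exact Nat.sInf_le ⟨k, H', F', h, hc'.trans hc, he'.trans he⟩
end
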